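/- arXiv:1401.2748 — 6 statements merged into one kernel-verified Lean document; each statement's English description precedes it below -/
import Mathlib

section
/- If F has characteristic 0, or characteristic p with p \u2265 r+s-1, then the Jordan canonical form of the Kronecker product J_r \u2297 J_s of unipotent Jordan blocks (with 1 \u2264 r \u2264 s) is the direct sum of Jordan blocks J_{r+s-1} \u2295 J_{r+s-3} \u2295 \u22ef \u2295 J_{s-r+1}; i.e., the Jordan partition is the standard partition \u03bb_i = r+s+1-2i for 1 \u2264 i \u2264 r. -/
open Matrix Kronecker

/-- The `k × k` upper-triangular Jordan block with eigenvalue `1`. -/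
def jordanBlock (F : Type*) [Zero F] [One F] (k : ℕ) : Matrix (Fin k) (Fin k) F :=
  Matrix.of fun i j => if j = i then 1 else if (j : ℕ) = (i : ℕ) + 1 then 1 else 0

/-- `lam : Fin r → ℕ` is the Jordan partition of the square matrix `M`
(with eigenvalue 1), characterized by: `lam` is weakly decreasing with positive
parts, and for every `k` the rank of `(M - 1)^k` equals `∑ i, max (lam i - k) 0`.
Over a field this holds iff `M` is similar to the direct sum of the unipotent
Jordan blocks `J_{lam i}`. -/
def IsJordanSeq {F : Type*} [CommRing F] {n : Type*} [Fintype n] [DecidableEq n]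
    {r : ℕ} (M : Matrix n n F) (lam : Fin r → ℕ) : Prop :=
  Antitone lam ∧ (∀ i, 0 < lam i) ∧
    ∀ k : ℕ, ((M - 1) ^ k).rank = ∑ i, (lam i - k)

namespace JTP

section abstract_part

variable {K V : Type*} [Field K] [AddCommGroup V] [Module K V]

lemma pow_shift {r : ℕ} (lam : Fin r → ℕ) (e : V →ₗ[K] V) (w : Fin r → ℕ → V)
    (h1 : ∀ i n, n + 1 < lam i → e (w i (n + 1)) = w i n) (i : Fin r) (k : ℕ) :
    ∀ n, n + k < lam i → (e ^ k) (w i (n + k)) = w i n := by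
  induction k with
  | zero => intro n _; simp
  | succ k ih =>
    intro n hn
    rw [pow_succ, Module.End.mul_apply, ← add_assoc, h1 i (n + k) (by omega)]
    exact ih n (by omega)

lemma pow_kill {r : ℕ} (lam : Fin r → ℕ) (e : V →ₗ[K] V) (w : Fin r → ℕ → V)
    (h0 : ∀ i, e (w i 0) = 0)
    (h1 : ∀ i n, n + 1 < lam i → e (w i (n + 1)) = w i n) (i : Fin r) (k n : ℕ)
    (hnk : n < k) (hn : n < lam i) : (e ^ k) (w i n) = 0 := by
  obtain ⟨m, rfl⟩ : ∃ m, k = m + (1 + n) := ⟨k - 1 - n, by omega⟩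
  have := pow_shift lam e w h1 i n 0 (by omega)
  rw [zero_add] at this
  rw [pow_add, pow_add, Module.End.mul_apply, Module.End.mul_apply, this, pow_one, h0, map_zero]

lemma indep {r : ℕ} (lam mu : Fin r → ℕ) (hmu : ∀ i, mu i ≤ lam i)
    (e : V →ₗ[K] V) (w : Fin r → ℕ → V)
    (h0 : ∀ i, e (w i 0) = 0)
    (h1 : ∀ i n, n + 1 < lam i → e (w i (n + 1)) = w i n)
    (hli : LinearIndependent K (fun i => w i 0)) :
    LinearIndependent K (fun x : (i : Fin r) × Fin (mu i) => w x.1 x.2) := by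
  classical
  rw [Fintype.linearIndependent_iff]
  intro g hg
  -- downward induction on the index
  have key : ∀ d N : ℕ, (∀ i, mu i ≤ N + d) →
      ∀ x : (i : Fin r) × Fin (mu i), N ≤ (x.2 : ℕ) → g x = 0 := by
    intro d
    induction d with
    | zero =>
      intro N hN x hx
      have := hN x.1
      have := x.2.2
      omega
    | succ d ih =>
      intro N hN
      have ih' := ih (N + 1) (fun i => by have := hN i; omega)
      have hE := congrArg (e ^ N) hg
      rw [map_sum, map_zero, Fintype.sum_sigma] at hE
      have hterm : ∀ i : Fin r,
          (∑ y : Fin (mu i), (e ^ N) (g ⟨i, y⟩ • w i y))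
            = (if h : N < mu i then g ⟨i, ⟨N, h⟩⟩ else 0) • w i 0 := by
        intro i
        have hz : ∀ y : Fin (mu i), (y : ℕ) ≠ N → (e ^ N) (g ⟨i, y⟩ • w i y) = 0 := by
          intro y hy
          rcases lt_or_gt_of_ne hy with h | h
          · rw [map_smul, pow_kill lam e w h0 h1 i N y h (lt_of_lt_of_le y.2 (hmu i)), smul_zero]
          · rw [ih' ⟨i, y⟩ (by simpa using h), zero_smul, map_zero]
        split_ifs with h
        · rw [Finset.sum_eq_single (⟨N, h⟩ : Fin (mu i))]
          · rw [map_smul]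
            have := pow_shift lam e w h1 i N 0 (by have := hmu i; omega)
            rw [zero_add] at this
            simp only [this]
          · intro y _ hy
            exact hz y (fun h' => hy (Fin.ext h'))
          · intro h'; exact absurd (Finset.mem_univ _) h'
        · rw [zero_smul]
          refine Finset.sum_eq_zero fun y _ => hz y ?_
          have := y.2
          omega
      simp only [hterm] at hE
      have hc := Fintype.linearIndependent_iff.mp hli _ hE
      rintro ⟨i, y⟩ hx
      rcases Nat.eq_or_lt_of_le hx with h | h
      · have hh := hc i
        have hlt : N < mu i := by have := y.2; simp only at h; omega
        rw [dif_pos hlt] at hh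
        have : y = ⟨N, hlt⟩ := Fin.ext h.symm
        rw [this]; exact hh
      · exact ih' ⟨i, y⟩ h
  intro x
  exact key (∑ i, mu i) 0 (fun i => by
    rw [zero_add]
    exact Finset.single_le_sum (f := mu) (fun _ _ => Nat.zero_le _) (Finset.mem_univ i)) x
    (Nat.zero_le _)

lemma card_le [FiniteDimensional K V] {r : ℕ} (mu : Fin r → ℕ) (w : Fin r → ℕ → V)
    (U : Submodule K V)
    (hli : LinearIndependent K (fun x : (i : Fin r) × Fin (mu i) => w x.1 x.2))
    (hU : ∀ i n, n < mu i → w i n ∈ U) : ∑ i, mu i ≤ Module.finrank K U := by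
  have h1 := finrank_span_eq_card hli
  have h2 : Submodule.span K (Set.range (fun x : (i : Fin r) × Fin (mu i) => w x.1 x.2)) ≤ U := by
    rw [Submodule.span_le]
    rintro _ ⟨x, rfl⟩
    exact hU _ _ x.2.2
  have h3 := Submodule.finrank_mono h2
  rw [h1] at h3
  simpa using h3

lemma rank_pow [FiniteDimensional K V] {r : ℕ} (lam : Fin r → ℕ)
    (e : V →ₗ[K] V) (w : Fin r → ℕ → V)
    (h0 : ∀ i, e (w i 0) = 0)
    (h1 : ∀ i n, n + 1 < lam i → e (w i (n + 1)) = w i n)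
    (hli : LinearIndependent K (fun i => w i 0))
    (hsum : ∑ i, lam i = Module.finrank K V) (k : ℕ) :
    Module.finrank K (LinearMap.range (e ^ k)) = ∑ i, (lam i - k) := by
  have hr := card_le (fun i => lam i - k) w (LinearMap.range (e ^ k))
    (indep lam _ (fun i => Nat.sub_le _ _) e w h0 h1 hli)
    (fun i n hn => ⟨w i (n + k), pow_shift lam e w h1 i k n (by omega)⟩)
  have hk := card_le (fun i => min (lam i) k) w (LinearMap.ker (e ^ k))
    (indep lam _ (fun i => min_le_left _ _) e w h0 h1 hli)
    (fun i n hn => pow_kill lam e w h0 h1 i k n (by omega) (by omega))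
  have ht := LinearMap.finrank_range_add_finrank_ker (e ^ k)
  have hs : ∑ i, (lam i - k) + ∑ i, min (lam i) k = ∑ i, lam i := by
    rw [← Finset.sum_add_distrib]
    exact Finset.sum_congr rfl fun i _ => by omega
  omega

end abstract_part

section functions

variable {F : Type*} [Field F]

/-- lowering operator on functions on `ℕ × ℕ` -/
def low (v : ℕ → ℕ → F) : ℕ → ℕ → F := fun a b => v (a + 1) b + v a (b + 1)

/-- raising operator -/
def up (r s : ℕ) (v : ℕ → ℕ → F) : ℕ → ℕ → F := fun a b =>
  (a : F) * ((r : F) - a) * v (a - 1) b + (b : F) * ((s : F) - b) * v a (b - 1)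

/-- alternating vector of degree `i` -/
def prim (i : ℕ) : ℕ → ℕ → F := fun a b => if a + b = i then (-1) ^ a else 0

lemma low_prim (i : ℕ) : low (prim i : ℕ → ℕ → F) = 0 := by
  funext a b
  simp only [low, prim, Pi.zero_apply]
  by_cases h : a + 1 + b = i
  · rw [if_pos h, if_pos (by omega), pow_succ]; ring
  · rw [if_neg h, if_neg (by omega)]; ring

lemma low_up (r s : ℕ) (v : ℕ → ℕ → F) (a b : ℕ) :
    low (up r s v) a b = up r s (low v) a b
      + ((r : F) + s - 2 - 2 * ((a : F) + b)) * v a b := by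
  rcases a with _ | a <;> rcases b with _ | b <;> simp [low, up] <;> ring

/-- support in degree `d` -/
lemma up_iter_deg (r s i n : ℕ) :
    ∀ a b, a + b ≠ i + n → ((up r s)^[n] (prim i : ℕ → ℕ → F)) a b = 0 := by
  induction n with
  | zero => intro a b h; simp [prim] at h ⊢; intro h'; exact absurd h' h
  | succ n ih =>
    intro a b h
    rw [Function.iterate_succ_apply']
    simp only [up]
    have e1 : (a : F) * ((r : F) - a) * ((up r s)^[n] (prim i : ℕ → ℕ → F)) (a - 1) b = 0 := by
      rcases a with _ | a
      · simp
      · rw [ih _ _ (by omega), mul_zero]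
    have e2 : (b : F) * ((s : F) - b) * ((up r s)^[n] (prim i : ℕ → ℕ → F)) a (b - 1) = 0 := by
      rcases b with _ | b
      · simp
      · rw [ih _ _ (by omega), mul_zero]
    rw [e1, e2, add_zero]

lemma up_iter_supp (r s i n : ℕ) (hi : i < r) (hrs : r ≤ s) :
    ∀ a b, (r ≤ a ∨ s ≤ b) → ((up r s)^[n] (prim i : ℕ → ℕ → F)) a b = 0 := by
  induction n with
  | zero => intro a b h; simp only [Function.iterate_zero, id, prim]; rw [if_neg (by omega)]
  | succ n ih =>
    intro a b h
    rw [Function.iterate_succ_apply']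
    simp only [up]
    have e1 : (a : F) * ((r : F) - a) * ((up r s)^[n] (prim i : ℕ → ℕ → F)) (a - 1) b = 0 := by
      by_cases h' : a = r
      · subst h'; simp
      · rw [ih _ _ (by omega), mul_zero]
    have e2 : (b : F) * ((s : F) - b) * ((up r s)^[n] (prim i : ℕ → ℕ → F)) a (b - 1) = 0 := by
      by_cases h' : b = s
      · subst h'; simp
      · rw [ih _ _ (by omega), mul_zero]
    rw [e1, e2, add_zero]

lemma up_smul (r s : ℕ) (c : F) (v : ℕ → ℕ → F) : up r s (c • v) = c • up r s v := by
  funext a b; simp only [up, Pi.smul_apply, smul_eq_mul]; ring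

lemma low_smul (c : F) (v : ℕ → ℕ → F) : low (c • v) = c • low v := by
  funext a b; simp only [low, Pi.smul_apply, smul_eq_mul]; ring

lemma low_up_iter (r s i n : ℕ) :
    low ((up r s)^[n + 1] (prim i : ℕ → ℕ → F))
      = (((n : F) + 1) * ((r : F) + s - 1 - 2 * i - (n + 1))) • (up r s)^[n] (prim i) := by
  induction n with
  | zero =>
    funext a b
    rw [Function.iterate_succ_apply', low_up]
    simp only [Function.iterate_zero, id, low_prim, Pi.smul_apply, smul_eq_mul]
    by_cases h : a + b = i
    · subst h
      have hz : up r s (0 : ℕ → ℕ → F) a b = 0 := by simp [up]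
      rw [hz]; push_cast; ring
    · simp [up, prim, h]
  | succ n ih =>
    funext a b
    rw [Function.iterate_succ_apply', low_up, ih, up_smul, ← Function.iterate_succ_apply' (up r s)]
    simp only [Pi.smul_apply, smul_eq_mul]
    by_cases h : a + b = i + (n + 1)
    · have h' : (a : F) + b = i + (n + 1) := by exact_mod_cast congrArg (Nat.cast (R := F)) h
      rw [h']; push_cast; ring
    · rw [up_iter_deg r s i (n + 1) a b h]; ring

/-- normalized chain -/
noncomputable def chain (F : Type*) [Field F] (r s i n : ℕ) : ℕ → ℕ → F :=
  (∏ j ∈ Finset.range n, (((j : F) + 1) * ((r : F) + s - 1 - 2 * i - (j + 1))))⁻¹ •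
    (up r s)^[n] (prim i : ℕ → ℕ → F)

lemma coef_ne (r s i n : ℕ) (hchar : ringChar F = 0 ∨ r + s - 1 ≤ ringChar F)
    (hn : n + 1 < r + s - 1 - 2 * i) :
    (((n : F) + 1) * ((r : F) + s - 1 - 2 * i - (n + 1))) ≠ 0 := by
  have key : ∀ m : ℕ, 0 < m → m < r + s - 1 → (m : F) ≠ 0 := by
    intro m h0 h1 h
    have hd := (ringChar.spec F m).mp h
    rcases hchar with hc | hc
    · rw [hc] at hd; have := zero_dvd_iff.mp hd; omega
    · have := Nat.le_of_dvd h0 hd; omega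
  refine mul_ne_zero ?_ ?_
  · have := key (n + 1) (by omega) (by omega)
    exact_mod_cast this
  · obtain ⟨m, hm⟩ : ∃ m, r + s = m + 1 + 2 * i + (n + 1) :=
      ⟨r + s - 1 - 2 * i - (n + 1), by omega⟩
    have h2 : (r : F) + s = m + 1 + 2 * i + (n + 1) := by
      exact_mod_cast congrArg (Nat.cast (R := F)) hm
    have := key m (by omega) (by omega)
    rw [h2]
    convert this using 1
    ring

lemma low_chain (r s i n : ℕ) (hchar : ringChar F = 0 ∨ r + s - 1 ≤ ringChar F)
    (hn : n + 1 < r + s - 1 - 2 * i) :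
    low (chain F r s i (n + 1)) = chain F r s i n := by
  rw [chain, low_smul, low_up_iter, chain, smul_smul, Finset.prod_range_succ, mul_inv, mul_assoc,
    inv_mul_cancel₀ (coef_ne r s i n hchar hn), mul_one]

lemma chain_zero (r s i : ℕ) : chain F r s i 0 = prim i := by simp [chain]

lemma chain_supp (r s i n : ℕ) (hi : i < r) (hrs : r ≤ s) (a b : ℕ) (h : r ≤ a ∨ s ≤ b) :
    chain F r s i n a b = 0 := by
  simp only [chain, Pi.smul_apply]
  rw [up_iter_supp r s i n hi hrs a b h, smul_zero]

end functions

section matrices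

variable {F : Type*} [Field F]

/-- nilpotent Jordan block -/
def nil (F : Type*) [Field F] (k : ℕ) : Matrix (Fin k) (Fin k) F :=
  Matrix.of fun i j => if (j : ℕ) = (i : ℕ) + 1 then 1 else 0

lemma jordan_eq (k : ℕ) : jordanBlock F k = 1 + nil F k := by
  ext i j
  simp only [jordanBlock, nil, Matrix.add_apply, Matrix.of_apply, Matrix.one_apply]
  by_cases h : j = i
  · subst h; simp
  · simp [h, Ne.symm h]

lemma nil_sum (k : ℕ) (g : ℕ → F) (hg : g k = 0) (i : Fin k) :
    ∑ j : Fin k, nil F k i j * g j = g (i + 1) := by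
  simp only [nil, Matrix.of_apply, ite_mul, one_mul, zero_mul]
  by_cases h : (i : ℕ) + 1 < k
  · rw [Finset.sum_eq_single (⟨i + 1, h⟩ : Fin k)]
    · simp
    · intro j _ hj; rw [if_neg (fun h' => hj (Fin.ext h'))]
    · intro h'; exact absurd (Finset.mem_univ _) h'
  · have : (i : ℕ) + 1 = k := by have := i.2; omega
    rw [this, hg]
    exact Finset.sum_eq_zero fun j _ => if_neg (by have := j.2; omega)

lemma sum_nil (k : ℕ) (g : ℕ → F) (j : Fin k) :
    ∑ i : Fin k, g i * nil F k i j = if (j : ℕ) = 0 then 0 else g (j - 1) := by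
  simp only [nil, Matrix.of_apply, mul_ite, mul_one, mul_zero]
  split_ifs with h
  · exact Finset.sum_eq_zero fun i _ => if_neg (by omega)
  · rw [Finset.sum_eq_single (⟨j - 1, by omega⟩ : Fin k)]
    · rw [if_pos]; simp only; omega
    · intro i _ hi
      rw [if_neg]
      intro h'; apply hi; apply Fin.ext; simp only; omega
    · intro h'; exact absurd (Finset.mem_univ _) h'

/-- Pascal matrix -/
def pas (F : Type*) [Field F] (k : ℕ) : Matrix (Fin k) (Fin k) F :=
  Matrix.of fun i j => ((Nat.choose j i : ℕ) : F)

lemma pas_det (k : ℕ) : (pas F k).det = 1 := by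
  rw [Matrix.det_of_isUpperTriangular]
  · simp [pas]
  · intro i j h
    simp only [pas, Matrix.of_apply]
    rw [Nat.choose_eq_zero_of_lt (by simpa using h), Nat.cast_zero]

lemma jordan_det (k : ℕ) : (jordanBlock F k).det = 1 := by
  rw [Matrix.det_of_isUpperTriangular]
  · simp [jordanBlock]
  · intro i j h
    have h' : (j : ℕ) < i := by simpa using h
    simp only [jordanBlock, Matrix.of_apply]
    rw [if_neg (fun e => by rw [e] at h'; omega), if_neg (by omega)]

lemma pas_rel (k : ℕ) : nil F k * pas F k = jordanBlock F k * pas F k * nil F k := by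
  have hNP : ∀ i j : Fin k, (nil F k * pas F k) i j = ((Nat.choose j (i + 1) : ℕ) : F) := by
    intro i j
    rw [Matrix.mul_apply]
    exact nil_sum k (fun m => ((Nat.choose j m : ℕ) : F))
      (by rw [Nat.choose_eq_zero_of_lt j.2, Nat.cast_zero]) i
  ext i j
  rw [hNP, jordan_eq, Matrix.add_mul, Matrix.one_mul, Matrix.mul_apply]
  simp only [Matrix.add_apply, hNP]
  have := sum_nil k (fun m => ((Nat.choose m i : ℕ) : F) + ((Nat.choose m (i + 1) : ℕ) : F)) j
  simp only [pas, Matrix.of_apply]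
  rw [this]
  split_ifs with h
  · rw [h]; simp
  · obtain ⟨m, hm⟩ : ∃ m, (j : ℕ) = m + 1 := ⟨j - 1, by omega⟩
    rw [hm, Nat.choose_succ_succ]; push_cast; simp

/-- the sum of the two commuting nilpotents -/
def EE (F : Type*) [Field F] (r s : ℕ) : Matrix (Fin r × Fin s) (Fin r × Fin s) F :=
  nil F r ⊗ₖ 1 + 1 ⊗ₖ nil F s

lemma inter (r s : ℕ) :
    (jordanBlock F r ⊗ₖ jordanBlock F s - 1) * (1 ⊗ₖ pas F s)
      = (1 ⊗ₖ jordanBlock F s) * (1 ⊗ₖ pas F s) * EE F r s := by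
  have h1 : (jordanBlock F r ⊗ₖ jordanBlock F s - 1 : Matrix (Fin r × Fin s) (Fin r × Fin s) F)
      = nil F r ⊗ₖ jordanBlock F s + 1 ⊗ₖ nil F s := by
    have : jordanBlock F r ⊗ₖ jordanBlock F s
        = nil F r ⊗ₖ jordanBlock F s + 1 ⊗ₖ nil F s + (1 : Matrix (Fin r × Fin s) (Fin r × Fin s) F) := by
      rw [← Matrix.one_kronecker_one (α := F) (m := Fin r) (n := Fin s), add_assoc,
        ← Matrix.kronecker_add, add_comm (nil F s), ← jordan_eq, ← Matrix.add_kronecker,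
        add_comm (nil F r), ← jordan_eq]
    rw [this, add_sub_cancel_right]
  rw [h1, EE, Matrix.add_mul, Matrix.mul_add, ← Matrix.mul_kronecker_mul,
    ← Matrix.mul_kronecker_mul, ← Matrix.mul_kronecker_mul, ← Matrix.mul_kronecker_mul,
    ← Matrix.mul_kronecker_mul, pas_rel]
  simp

lemma inter_comm (r s : ℕ) :
    (jordanBlock F r ⊗ₖ jordanBlock F s - 1) * (1 ⊗ₖ jordanBlock F s)
      = (1 ⊗ₖ jordanBlock F s) * (jordanBlock F r ⊗ₖ jordanBlock F s - 1) := by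
  rw [Matrix.sub_mul, Matrix.mul_sub, ← Matrix.mul_kronecker_mul, ← Matrix.mul_kronecker_mul]
  simp

lemma inter_pow (r s k : ℕ) :
    (jordanBlock F r ⊗ₖ jordanBlock F s - 1) ^ k * (1 ⊗ₖ pas F s)
      = (1 ⊗ₖ jordanBlock F s) ^ k * (1 ⊗ₖ pas F s) * EE F r s ^ k := by
  induction k with
  | zero => simp
  | succ k ih =>
    have hc : Commute (jordanBlock F r ⊗ₖ jordanBlock F s - 1)
      ((1 : Matrix (Fin r) (Fin r) F) ⊗ₖ jordanBlock F s) := inter_comm r s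
    rw [pow_succ', Matrix.mul_assoc, ih, ← Matrix.mul_assoc, ← Matrix.mul_assoc,
      (hc.pow_right k).eq, Matrix.mul_assoc (_ ^ k), inter, pow_succ, pow_succ']
    simp only [Matrix.mul_assoc]

lemma rank_eq (r s k : ℕ) :
    ((jordanBlock F r ⊗ₖ jordanBlock F s - 1) ^ k).rank = (EE F r s ^ k).rank := by
  have hP : IsUnit ((1 : Matrix (Fin r) (Fin r) F) ⊗ₖ pas F s).det := by
    rw [Matrix.det_kronecker, pas_det]; simp
  have hJ : IsUnit ((1 : Matrix (Fin r) (Fin r) F) ⊗ₖ jordanBlock F s).det := by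
    rw [Matrix.det_kronecker, jordan_det]; simp
  rw [← Matrix.rank_mul_eq_left_of_isUnit_det _ ((jordanBlock F r ⊗ₖ jordanBlock F s - 1) ^ k) hP,
    inter_pow, Matrix.rank_mul_eq_right_of_isUnit_det]
  rw [Matrix.det_mul, Matrix.det_pow]
  exact (hJ.pow k).mul hP

/-- restriction -/
def res (r s : ℕ) (v : ℕ → ℕ → F) : Fin r × Fin s → F := fun x => v x.1 x.2

lemma EE_res (r s : ℕ) (v : ℕ → ℕ → F) (hv : ∀ a b, (r ≤ a ∨ s ≤ b) → v a b = 0) :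
    (EE F r s).mulVecLin (res r s v) = res r s (low v) := by
  funext ⟨a, b⟩
  rw [Matrix.mulVecLin_apply, EE, Matrix.add_mulVec]
  simp only [Pi.add_apply, Matrix.mulVec, dotProduct, res, low, Matrix.kronecker_apply,
    Fintype.sum_prod_type]
  congr 1
  · rw [← nil_sum r (fun x => v x b) (hv _ _ (Or.inl le_rfl)) a]
    refine Finset.sum_congr rfl fun x _ => ?_
    rw [Finset.sum_eq_single b]
    · simp
    · intro y _ hy; simp [Matrix.one_apply_ne hy.symm]
    · intro h'; exact absurd (Finset.mem_univ _) h'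
  · rw [← nil_sum s (fun y => v a y) (hv _ _ (Or.inr le_rfl)) b, Finset.sum_eq_single a]
    · simp
    · intro y _ hy; simp [Matrix.one_apply_ne hy.symm]
    · intro h'; exact absurd (Finset.mem_univ _) h'

lemma sum_lam (r s : ℕ) (hrs : r ≤ s) : ∑ i : Fin r, (r + s - 1 - 2 * (i : ℕ)) = r * s := by
  rw [Fin.sum_univ_eq_sum_range (fun i => r + s - 1 - 2 * i)]
  have : ∀ m, m ≤ r → ∑ i ∈ Finset.range m, (r + s - 1 - 2 * i) + m * m = m * (r + s) := by
    intro m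
    induction m with
    | zero => simp
    | succ m ih =>
      intro hm
      rw [Finset.sum_range_succ]
      have := ih (by omega)
      obtain ⟨t, ht⟩ : ∃ t, r + s = t + 1 + 2 * m := ⟨r + s - 1 - 2 * m, by omega⟩
      have h2 : r + s - 1 - 2 * m = t := by omega
      rw [h2]
      nlinarith
  have := this r le_rfl
  nlinarith

end matrices

end JTP

open JTP in
/-- In characteristic `0` or `p ≥ r+s-1`, the Jordan partition of `J_r ⊗ J_s`
is the standard partition `λ_i = r+s+1-2i`. -/
theorem stmt4 (F : Type*) [Field F] (r s : ℕ) (hr : 1 ≤ r) (hrs : r ≤ s)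
    (hchar : ringChar F = 0 ∨ r + s - 1 ≤ ringChar F) :
    IsJordanSeq (jordanBlock F r ⊗ₖ jordanBlock F s)
      (fun i : Fin r => r + s - 1 - 2 * (i : ℕ)) := by
  refine ⟨fun i j h => ?_, fun i => ?_, fun k => ?_⟩
  · have h' : (i : ℕ) ≤ j := h
    simp only
    omega
  · have := i.2
    simp only
    omega
  · rw [rank_eq, Matrix.rank, ← Matrix.toLin'_apply', Matrix.toLin'_pow]
    refine rank_pow (fun i : Fin r => r + s - 1 - 2 * (i : ℕ)) _
      (fun i n => res r s (chain F r s i n)) ?_ ?_ ?_ ?_ k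
    · intro i
      rw [Matrix.toLin'_apply', EE_res r s _ (chain_supp r s i 0 i.2 hrs), chain_zero, low_prim]
      rfl
    · intro i n hn
      rw [Matrix.toLin'_apply', EE_res r s _ (chain_supp r s i (n + 1) i.2 hrs),
        low_chain r s i n hchar hn]
    · rw [Fintype.linearIndependent_iff]
      intro g hg i
      have h := congrFun hg (⟨0, hr⟩, ⟨i, lt_of_lt_of_le i.2 hrs⟩)
      simp only [Finset.sum_apply, Pi.smul_apply, chain_zero, res, prim, smul_eq_mul,
        Pi.zero_apply, zero_add, pow_zero, mul_ite, mul_one, mul_zero] at h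
      rw [Finset.sum_eq_single i] at h
      · simpa using h
      · intro j _ hj
        rw [if_neg (fun h' => hj (Fin.ext h'.symm))]
      · intro h'; exact absurd (Finset.mem_univ _) h'
    · rw [sum_lam r s hrs]; simp
end

section
/- Let F have characteristic p > 0 and let 1 \u2264 r \u2264 s. If s is not congruent to any of 0, \u00b11, \u00b12, \u2026, \u00b1(r-2) modulo p, then the Jordan partition \u03bb(r,s,p) of J_r \u2297 J_s is the standard partition: \u03bb_i = r+s+1-2i for 1 \u2264 i \u2264 r. -/
open Matrix Kronecker

namespace JP

variable {F : Type*} [Field F]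

/-- the truncation change of basis coefficients -/
def cc (F : Type*) [Field F] : ℕ → ℕ → F
  | 0, 0 => 1
  | 0, _ + 1 => 0
  | _ + 1, 0 => 0
  | a + 1, b + 1 => cc F a b - cc F (a + 1) b

lemma cc_lt (b : ℕ) : ∀ a, b < a → cc F a b = 0 := by
  induction b with
  | zero => intro a h; cases a with
    | zero => omega
    | succ a => simp [cc]
  | succ b ih => intro a h; cases a with
    | zero => omega
    | succ a => simp [cc, ih a (by omega), ih (a+1) (by omega)]

lemma cc_diag (a : ℕ) : cc F a a = 1 := by
  induction a with
  | zero => simp [cc]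
  | succ a ih => simp [cc, ih, cc_lt a (a+1) (by omega)]

/-- nilpotent shift -/
def NN (F : Type*) [Field F] (k : ℕ) : Matrix (Fin k) (Fin k) F :=
  Matrix.of fun i j => if (j : ℕ) = (i : ℕ) + 1 then 1 else 0

lemma jordan_eq (k : ℕ) : jordanBlock F k = 1 + NN F k := by
  ext i j
  simp only [jordanBlock, NN, Matrix.of_apply, Matrix.add_apply, Matrix.one_apply]
  by_cases h : j = i
  · subst h; simp
  · simp [h, Ne.symm h]

def PP (F : Type*) [Field F] (k : ℕ) : Matrix (Fin k) (Fin k) F :=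
  Matrix.of fun i j => cc F i j

lemma PP_det (k : ℕ) : (PP F k).det = 1 := by
  rw [Matrix.det_of_isUpperTriangular]
  · simp [PP, cc_diag]
  · intro i j h
    simp only [PP, Matrix.of_apply]
    exact cc_lt _ _ (by simpa using h)

lemma mul_NN (k : ℕ) (A : Matrix (Fin k) (Fin k) F) (i j : Fin k) :
    (A * NN F k) i j = if h : 0 < (j : ℕ) then A i ⟨j - 1, by omega⟩ else 0 := by
  rw [Matrix.mul_apply]
  split_ifs with h
  · rw [Finset.sum_eq_single ⟨(j : ℕ) - 1, by omega⟩]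
    · simp only [NN, Matrix.of_apply]; rw [if_pos (by omega)]; simp
    · intro b _ hb
      simp only [NN, Matrix.of_apply]; rw [if_neg, mul_zero]
      intro h'; apply hb; ext; simp; omega
    · simp
  · apply Finset.sum_eq_zero
    intro b _
    simp only [NN, Matrix.of_apply]; rw [if_neg (by omega), mul_zero]

lemma NN_mul (k : ℕ) (A : Matrix (Fin k) (Fin k) F) (i j : Fin k) :
    (NN F k * A) i j = if h : (i : ℕ) + 1 < k then A ⟨i + 1, h⟩ j else 0 := by
  rw [Matrix.mul_apply]
  split_ifs with h
  · rw [Finset.sum_eq_single ⟨(i : ℕ) + 1, h⟩]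
    · simp only [NN, Matrix.of_apply]; simp
    · intro b _ hb
      simp only [NN, Matrix.of_apply]; rw [if_neg, zero_mul]
      intro h'; apply hb; ext; simp; omega
    · simp
  · apply Finset.sum_eq_zero
    intro b _
    simp only [NN, Matrix.of_apply]; rw [if_neg (by omega), zero_mul]

lemma PP_comm (k : ℕ) : PP F k * NN F k = NN F k * (PP F k * (1 + NN F k)) := by
  ext i j
  rw [mul_NN, NN_mul, mul_add, mul_one]
  simp only [Matrix.add_apply, mul_NN]
  obtain ⟨i, hi⟩ := i
  obtain ⟨j, hj⟩ := j
  simp only [PP, Matrix.of_apply]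
  cases j with
  | zero => simp [cc]
  | succ j =>
    simp only [Nat.succ_pos, dite_true, Nat.add_sub_cancel]
    split_ifs with h
    · simp [cc]
    · exact cc_lt _ _ (by omega)

/-- graded version of the nilpotent operator -/
def EE (F : Type*) [Field F] (r s : ℕ) : Matrix (Fin r × Fin s) (Fin r × Fin s) F :=
  NN F r ⊗ₖ 1 + 1 ⊗ₖ NN F s

lemma rank_eq (r s k : ℕ) :
    ((jordanBlock F r ⊗ₖ jordanBlock F s - 1) ^ k).rank = (EE F r s ^ k).rank := by
  set Z := jordanBlock F r ⊗ₖ jordanBlock F s - 1 with hZ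
  set Q : Matrix (Fin r × Fin s) (Fin r × Fin s) F := (1 : Matrix (Fin r) (Fin r) F) ⊗ₖ PP F s with hQ
  set U : Matrix (Fin r × Fin s) (Fin r × Fin s) F :=
    (1 : Matrix (Fin r) (Fin r) F) ⊗ₖ jordanBlock F s with hU
  have hZ' : Z = NN F r ⊗ₖ (1 + NN F s) + 1 ⊗ₖ NN F s := by
    rw [hZ, jordan_eq, jordan_eq, Matrix.add_kronecker, Matrix.kronecker_add 1 1,
      Matrix.one_kronecker_one]
    abel
  have h1 : Q * Z = EE F r s * (Q * U) := by
    rw [hZ', hQ, hU, EE, jordan_eq, mul_add, add_mul]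
    simp only [← Matrix.mul_kronecker_mul, one_mul, mul_one]
    rw [PP_comm]
  have h2 : Commute U Z := by
    rw [hU, hZ]
    apply Commute.sub_right _ (Commute.one_right _)
    simp only [Commute, SemiconjBy, ← Matrix.mul_kronecker_mul, one_mul, mul_one]
  have h3 : ∀ k, Q * Z ^ k = EE F r s ^ k * (Q * U ^ k) := by
    intro k
    induction k with
    | zero => simp
    | succ k ih =>
      calc Q * Z ^ (k+1) = (Q * Z ^ k) * Z := by rw [pow_succ, mul_assoc]
        _ = EE F r s ^ k * (Q * (U ^ k * Z)) := by rw [ih]; simp only [mul_assoc]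
        _ = EE F r s ^ k * ((Q * Z) * U ^ k) := by rw [(h2.pow_left k).eq]; simp only [mul_assoc]
        _ = _ := by rw [h1, pow_succ, pow_succ' U]; simp only [mul_assoc]
  have hQd : IsUnit Q.det := by
    rw [hQ, Matrix.det_kronecker, PP_det]; simp
  have hJ : (jordanBlock F s).det = 1 := by
    rw [Matrix.det_of_isUpperTriangular]
    · simp [jordanBlock]
    · intro i j h
      have h' : j < i := by simpa using h
      simp only [jordanBlock, Matrix.of_apply]
      rw [if_neg h'.ne, if_neg]
      have : (j : ℕ) < i := h'
      omega
  have hUd : IsUnit U.det := by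
    rw [hU, Matrix.det_kronecker, hJ]; simp
  rw [← Matrix.rank_mul_eq_right_of_isUnit_det Q (Z ^ k) hQd, h3 k,
    Matrix.rank_mul_eq_left_of_isUnit_det]
  rw [Matrix.det_mul, Matrix.det_pow]
  exact hQd.mul (hUd.pow k)

/-- The shift operators on functions. -/
def X (F : Type*) [Field F] : Module.End F (ℕ → ℕ → F) where
  toFun v := fun a b => v (a + 1) b
  map_add' _ _ := rfl
  map_smul' _ _ := rfl

def Y (F : Type*) [Field F] : Module.End F (ℕ → ℕ → F) where
  toFun v := fun a b => v a (b + 1)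
  map_add' _ _ := rfl
  map_smul' _ _ := rfl

def E (F : Type*) [Field F] : Module.End F (ℕ → ℕ → F) := X F + Y F

lemma E_apply (v : ℕ → ℕ → F) (a b : ℕ) : E F v a b = v (a + 1) b + v a (b + 1) := rfl

def R (F : Type*) [Field F] (r s : ℕ) : Module.End F (ℕ → ℕ → F) where
  toFun v := fun a b => (a : F) * (r - a) * v (a - 1) b + (b : F) * (s - b) * v a (b - 1)
  map_add' u v := by ext a b; simp; ring
  map_smul' c v := by ext a b; simp; ring

lemma R_apply (r s : ℕ) (v : ℕ → ℕ → F) (a b : ℕ) :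
    R F r s v a b = (a : F) * (r - a) * v (a - 1) b + (b : F) * (s - b) * v a (b - 1) := rfl

/-- `v` is an eigenvector for the weight operator. -/
def Wt (r s : ℕ) (c : F) (v : ℕ → ℕ → F) : Prop :=
  ∀ a b, ((r : F) + s - 2 - 2 * (a + b)) * v a b = c * v a b

lemma Wt.stepE {r s : ℕ} {c : F} {v : ℕ → ℕ → F} (h : Wt r s c v) : Wt r s (c + 2) (E F v) := by
  intro a b
  have h1 := h (a + 1) b
  have h2 := h a (b + 1)
  push_cast at h1 h2
  rw [E_apply]
  linear_combination h1 + h2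

lemma ER {r s : ℕ} {c : F} {v : ℕ → ℕ → F} (h : Wt r s c v) :
    E F (R F r s v) = R F r s (E F v) + c • v := by
  ext a b
  have h1 := h a b
  simp only [Pi.add_apply, Pi.smul_apply, smul_eq_mul, E_apply, R_apply, Nat.add_sub_cancel]
  rw [← h1]
  cases a <;> cases b <;> simp <;> ring

lemma EmR {r s : ℕ} (m : ℕ) : ∀ {c : F} {v : ℕ → ℕ → F}, Wt r s c v →
    (E F ^ (m + 1)) (R F r s v) =
      R F r s ((E F ^ (m + 1)) v) + (((m : F) + 1) * (c + m)) • (E F ^ m) v := by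
  induction m with
  | zero => intro c v h; simp [ER h]
  | succ m ih =>
    intro c v h
    rw [pow_succ, Module.End.mul_apply, ER h, map_add, ih h.stepE, map_smul,
      ← Module.End.mul_apply (E F ^ m), ← pow_succ, ← Module.End.mul_apply (E F ^ (m + 1)),
      add_assoc, ← add_smul]
    congr 2
    push_cast; ring

def Supp (r s : ℕ) (v : ℕ → ℕ → F) : Prop := ∀ a b, (r ≤ a ∨ s ≤ b) → v a b = 0

def Hom (d : ℕ) (v : ℕ → ℕ → F) : Prop := ∀ a b, a + b ≠ d → v a b = 0

lemma Supp.stepE {r s : ℕ} {v : ℕ → ℕ → F} (h : Supp r s v) : Supp r s (E F v) := by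
  intro a b hab
  rw [E_apply, h _ _ (by omega), h _ _ (by omega), add_zero]

lemma Supp.Epow {r s : ℕ} {v : ℕ → ℕ → F} (h : Supp r s v) (m : ℕ) :
    Supp r s ((E F ^ m) v) := by
  induction m with
  | zero => simpa using h
  | succ m ih => rw [pow_succ', Module.End.mul_apply]; exact ih.stepE

lemma Supp.stepR {r s : ℕ} {v : ℕ → ℕ → F} (h : Supp r s v) : Supp r s (R F r s v) := by
  intro a b hab
  rw [R_apply]
  have h1 : ((a : F) * (r - a)) * v (a - 1) b = 0 := by
    rcases hab with hab | hab
    · rcases hab.eq_or_lt with e | e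
      · subst e; simp
      · rw [h _ _ (by omega), mul_zero]
    · rw [h _ _ (by omega), mul_zero]
  have h2 : ((b : F) * (s - b)) * v a (b - 1) = 0 := by
    rcases hab with hab | hab
    · rw [h _ _ (by omega), mul_zero]
    · rcases hab.eq_or_lt with e | e
      · subst e; simp
      · rw [h _ _ (by omega), mul_zero]
  rw [h1, h2, add_zero]

lemma Hom.stepR {r s d : ℕ} {v : ℕ → ℕ → F} (h : Hom d v) : Hom (d + 1) (R F r s v) := by
  intro a b hab
  rw [R_apply]
  have h1 : ((a : F) * (r - a)) * v (a - 1) b = 0 := by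
    cases a with
    | zero => simp
    | succ a => rw [h _ _ (by simp; omega), mul_zero]
  have h2 : ((b : F) * (s - b)) * v a (b - 1) = 0 := by
    cases b with
    | zero => simp
    | succ b => rw [h _ _ (by simp; omega), mul_zero]
  rw [h1, h2, add_zero]

lemma Hom.wt {r s d : ℕ} {v : ℕ → ℕ → F} (h : Hom d v) :
    Wt r s ((r : F) + s - 2 - 2 * d) v := by
  intro a b
  by_cases e : a + b = d
  · subst e; push_cast; ring
  · rw [h a b e]; simp

lemma X_pow (k : ℕ) (v : ℕ → ℕ → F) (a b : ℕ) : (X F ^ k) v a b = v (a + k) b := by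
  induction k generalizing a with
  | zero => simp
  | succ k ih =>
    rw [pow_succ', Module.End.mul_apply]
    show (X F ^ k) v (a + 1) b = _
    rw [ih]; congr 1; omega

lemma Y_pow (k : ℕ) (v : ℕ → ℕ → F) (a b : ℕ) : (Y F ^ k) v a b = v a (b + k) := by
  induction k generalizing b with
  | zero => simp
  | succ k ih =>
    rw [pow_succ', Module.End.mul_apply]
    show (Y F ^ k) v a (b + 1) = _
    rw [ih]; congr 1; omega

lemma E_pow_p (p : ℕ) [CharP F p] (hp : p.Prime) : E F ^ p = X F ^ p + Y F ^ p := by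
  have := Fact.mk hp
  have : CharP (Module.End F (ℕ → ℕ → F)) p :=
    charP_of_injective_algebraMap (algebraMap F (Module.End F (ℕ → ℕ → F))).injective p
  exact add_pow_char_of_commute p (show Commute (X F) (Y F) from rfl)

lemma E_pow_qp (p : ℕ) [CharP F p] (hp : p.Prime) {r s : ℕ} (hr : r ≤ p) (q : ℕ)
    {v : ℕ → ℕ → F} (h : Supp r s v) (a b : ℕ) : (E F ^ (q * p)) v a b = v a (b + q * p) := by
  induction q generalizing a b with
  | zero => simp
  | succ q ih =>
    have hs := h.Epow (q * p)
    rw [show (q + 1) * p = p + q * p by ring, pow_add, Module.End.mul_apply, E_pow_p p hp,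
      LinearMap.add_apply, Pi.add_apply, Pi.add_apply, X_pow, Y_pow, hs _ _ (by omega), ih,
      zero_add, add_assoc]

lemma natCast_ne (p : ℕ) [CharP F p] {n : ℕ} (q : ℕ) (h1 : q * p < n) (h2 : n < q * p + p) :
    (n : F) ≠ 0 := by
  rw [Ne, CharP.cast_eq_zero_iff F p]
  rintro ⟨k, rfl⟩
  have a1 : q < k := by
    by_contra h
    have : p * k ≤ q * p := by rw [mul_comm]; exact Nat.mul_le_mul_right p (by omega)
    omega
  have a2 : (q + 1) * p ≤ k * p := Nat.mul_le_mul_right p a1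
  rw [mul_comm k p] at a2
  linarith

lemma main_step (p : ℕ) [CharP F p] (hp : p.Prime) {r s q t : ℕ} (hst : s = q * p + t)
    (h1 : r ≤ t + 1) (h2 : r + t ≤ p + 1) (htp : t < p) (j : ℕ)
    (hj : j + 2 ≤ r) (d : ℕ) (u : ℕ → ℕ → F) (hd : d + j + 2 = r + s) (hS : Supp r s u)
    (hH : Hom d u) (hE : (E F ^ (r + s - 2 - 2 * j)) u = 0) (hR : R F r s u = 0) : u = 0 := by
  obtain ⟨N, hN⟩ : ∃ N, r + s - 2 - 2 * j = N := ⟨_, rfl⟩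
  rw [hN] at hE
  have hc : (r : F) + s - 2 - 2 * d = - (N : F) := by
    have e1 : (d : F) + j + 2 = r + s := by exact_mod_cast congrArg (Nat.cast : ℕ → F) hd
    have e2 : (N : F) + 2 * j + 2 = r + s := by
      exact_mod_cast congrArg (Nat.cast : ℕ → F) (show N + 2 * j + 2 = r + s by omega)
    linear_combination e2 - 2 * e1
  have key : ∀ i, i ≤ N - q * p → (E F ^ (N - i)) u = 0 := by
    intro i
    induction i with
    | zero => intro _; simpa using hE
    | succ i ih =>
      intro hi
      have h3 := ih (by omega)
      obtain ⟨m, hm⟩ : ∃ m, N - (i + 1) = m := ⟨_, rfl⟩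
      rw [hm]
      rw [show N - i = m + 1 by omega] at h3
      have h4 := EmR m (hH.wt (r := r) (s := s))
      rw [hR, h3, map_zero, map_zero, zero_add, hc] at h4
      have h5 : ((m : F) + 1) ≠ 0 := by
        have := natCast_ne (F := F) p (n := m + 1) q (by omega) (by omega)
        exact_mod_cast this
      have h6 : (-(N : F) + m) ≠ 0 := by
        have := natCast_ne (F := F) p (n := i + 1) 0 (by omega) (by omega)
        have e : (N : F) = m + (i + 1 : ℕ) := by
          exact_mod_cast congrArg (Nat.cast : ℕ → F) (show N = m + (i + 1) by omega)
        rw [e]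
        intro h
        apply this
        linear_combination -h
      exact (smul_eq_zero.mp h4.symm).resolve_left (mul_ne_zero h5 h6)
  have h3 := key (N - q * p) le_rfl
  rw [show N - (N - q * p) = q * p by omega] at h3
  ext a b
  by_cases hab : a + b = d
  · by_cases ha : r ≤ a
    · exact hS a b (Or.inl ha)
    · have := E_pow_qp p hp (show r ≤ p by omega) q hS a (b - q * p)
      rw [h3, show b - q * p + q * p = b by omega] at this
      exact this.symm
  · exact hH a b hab

lemma main_inj (p : ℕ) [CharP F p] (hp : p.Prime) {r s q t : ℕ} (hst : s = q * p + t)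
    (h1 : r ≤ t + 1) (h2 : r + t ≤ p + 1) (htp : t < p) (j : ℕ) :
    j + 2 ≤ r → ∀ (d : ℕ) (u : ℕ → ℕ → F), d + j + 2 = r + s → Supp r s u → Hom d u →
      (E F ^ (r + s - 2 - 2 * j)) u = 0 → u = 0 := by
  induction j with
  | zero =>
    intro hj d u hd hS hH hE
    have hR : R F r s u = 0 := by
      ext a b
      by_cases h : a + b = d + 1
      · exact hS.stepR a b (by omega)
      · exact hH.stepR a b h
    exact main_step p hp hst h1 h2 htp 0 hj d u hd hS hH hE hR
  | succ j ih =>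
    intro hj d u hd hS hH hE
    refine main_step p hp hst h1 h2 htp (j + 1) hj d u hd hS hH hE ?_
    apply ih (by omega) (d + 1) _ (by omega) hS.stepR hH.stepR
    obtain ⟨N, hN⟩ : ∃ N, r + s - 2 - 2 * (j + 1) = N := ⟨_, rfl⟩
    rw [hN] at hE
    rw [show r + s - 2 - 2 * j = 1 + (N + 1) by omega, pow_add, Module.End.mul_apply,
      EmR N hH.wt, hE, pow_succ' (E F) N, Module.End.mul_apply, hE]
    simp

def comp (d : ℕ) (v : ℕ → ℕ → F) : ℕ → ℕ → F := fun a b => if a + b = d then v a b else 0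

lemma E_comp (d : ℕ) (v : ℕ → ℕ → F) : E F (comp (d + 1) v) = comp d (E F v) := by
  ext a b
  simp only [E_apply, comp]
  by_cases h : a + b = d
  · rw [if_pos (by omega), if_pos (by omega), if_pos h]
  · rw [if_neg (by omega), if_neg (by omega), if_neg h, add_zero]

lemma Epow_comp (d m : ℕ) (v : ℕ → ℕ → F) :
    (E F ^ m) (comp (d + m) v) = comp d ((E F ^ m) v) := by
  induction m generalizing v with
  | zero => simp
  | succ m ih =>
    rw [pow_succ, Module.End.mul_apply, ← add_assoc, E_comp, ih, Module.End.mul_apply]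

lemma E_comp_zero (d : ℕ) (v : ℕ → ℕ → F) (h : E F v = 0) : E F (comp d v) = 0 := by
  cases d with
  | zero => ext a b; simp [E_apply, comp]
  | succ d => rw [E_comp, h]; ext a b; simp [comp]

lemma Supp.comp {r s : ℕ} {v : ℕ → ℕ → F} (h : Supp r s v) (d : ℕ) : Supp r s (comp d v) := by
  intro a b hab
  simp [JP.comp, h a b hab]

lemma kernel_zero {w : ℕ → ℕ → F} (h : E F w = 0) (h0 : ∀ a, w a 0 = 0) : w = 0 := by
  have : ∀ b a, w a b = 0 := by
    intro b
    induction b with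
    | zero => exact h0
    | succ b ih =>
      intro a
      have := congrFun (congrFun h a) b
      rw [E_apply, ih] at this
      simpa using this
  ext a b
  exact this b a

lemma string_zero (p : ℕ) [CharP F p] (hp : p.Prime) {r s q t : ℕ} (hst : s = q * p + t)
    (h1 : r ≤ t + 1) (h2 : r + t ≤ p + 1) (htp : t < p) (hrs : r ≤ s) (m : ℕ) {u : ℕ → ℕ → F}
    (hS : Supp r s u) (hE : (E F ^ (m + 1)) u = 0)
    (h0 : ∀ a, a < r → m < r + s - 1 - 2 * a → (E F ^ m) u a 0 = 0) : (E F ^ m) u = 0 := by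
  have hE' : E F ((E F ^ m) u) = 0 := by
    rw [← Module.End.mul_apply, ← pow_succ', hE]
  apply kernel_zero hE'
  intro a
  by_cases ha : r ≤ a
  · exact hS.Epow m a 0 (Or.inl ha)
  by_cases hm : m < r + s - 1 - 2 * a
  · exact h0 a (by omega) hm
  have hu : comp (a + m) u = 0 := by
    by_cases hj : r + s < a + m + 2
    · ext x y
      simp only [comp]
      split_ifs with hxy
      · exact hS x y (by omega)
      · rfl
    · apply main_inj p hp hst h1 h2 htp (r + s - 2 - (a + m)) (by omega) (a + m) _ (by omega)
        (hS.comp _)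
      · intro x y hxy
        simp [comp, hxy]
      · obtain ⟨k, hk⟩ : ∃ k, r + s - 2 - 2 * (r + s - 2 - (a + m)) = k + 1 + m :=
          ⟨r + s - 2 - 2 * (r + s - 2 - (a + m)) - 1 - m, by omega⟩
        rw [hk, pow_add, Module.End.mul_apply, Epow_comp, pow_succ, Module.End.mul_apply,
          E_comp_zero _ _ hE', map_zero]
  have h3 := Epow_comp a m u
  rw [hu, map_zero] at h3
  have h4 := congrFun (congrFun h3 a) 0
  simpa [comp] using h4.symm

/-- zero extension -/
def ext0 (F : Type*) [Field F] (r s : ℕ) : (Fin r × Fin s → F) →ₗ[F] (ℕ → ℕ → F) where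
  toFun v := fun a b => if h : a < r ∧ b < s then v (⟨a, h.1⟩, ⟨b, h.2⟩) else 0
  map_add' u v := by ext a b; by_cases h : a < r ∧ b < s <;> simp [h]
  map_smul' c v := by ext a b; by_cases h : a < r ∧ b < s <;> simp [h]

lemma ext0_apply (r s : ℕ) (v : Fin r × Fin s → F) (a b : ℕ) :
    ext0 F r s v a b = if h : a < r ∧ b < s then v (⟨a, h.1⟩, ⟨b, h.2⟩) else 0 := rfl

lemma ext0_supp (r s : ℕ) (v : Fin r × Fin s → F) : Supp r s (ext0 F r s v) := by
  intro a b h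
  rw [ext0_apply, dif_neg (by omega)]

lemma ext0_inj (r s : ℕ) (v : Fin r × Fin s → F) (h : ext0 F r s v = 0) : v = 0 := by
  ext ⟨a, b⟩
  have := congrFun (congrFun h a) b
  rw [ext0_apply, dif_pos ⟨a.2, b.2⟩] at this
  exact this

lemma NN_sum (k : ℕ) (i : Fin k) (g : Fin k → F) :
    ∑ j, NN F k i j * g j = if h : (i : ℕ) + 1 < k then g ⟨i + 1, h⟩ else 0 := by
  split_ifs with h
  · rw [Finset.sum_eq_single ⟨(i : ℕ) + 1, h⟩]
    · simp only [NN, Matrix.of_apply]; simp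
    · intro b _ hb
      simp only [NN, Matrix.of_apply]; rw [if_neg, zero_mul]
      intro h'; apply hb; ext; simp; omega
    · simp
  · apply Finset.sum_eq_zero
    intro b _
    simp only [NN, Matrix.of_apply]; rw [if_neg (by omega), zero_mul]

lemma ext0_E (r s : ℕ) (v : Fin r × Fin s → F) :
    ext0 F r s ((EE F r s).mulVecLin v) = E F (ext0 F r s v) := by
  ext a b
  by_cases h : a < r ∧ b < s
  · rw [E_apply, ext0_apply, dif_pos h, EE, Matrix.mulVecLin_apply, Matrix.add_mulVec,
      Pi.add_apply]
    congr 1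
    · simp only [Matrix.mulVec, dotProduct, Fintype.sum_prod_type, Matrix.kronecker_apply,
        Matrix.one_apply, mul_ite, mul_one, mul_zero, ite_mul, zero_mul, Finset.sum_ite_eq,
        Finset.mem_univ, if_true]
      rw [NN_sum r ⟨a, h.1⟩ (fun x => v (x, ⟨b, h.2⟩)), ext0_apply]
      simp [h.2]
    · simp only [Matrix.mulVec, dotProduct, Fintype.sum_prod_type, Matrix.kronecker_apply]
      rw [Finset.sum_eq_single ⟨a, h.1⟩]
      · simp only [Matrix.one_apply_eq, one_mul]
        rw [NN_sum s ⟨b, h.2⟩ (fun x => v (⟨a, h.1⟩, x)), ext0_apply]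
        simp [h.1]
      · intro x _ hx
        simp [Matrix.one_apply_ne hx.symm]
      · simp
  · rw [ext0_supp r s _ a b (by omega), (ext0_supp r s v).stepE a b (by omega)]

lemma ext0_Epow (r s m : ℕ) (v : Fin r × Fin s → F) :
    ext0 F r s (((EE F r s).mulVecLin ^ m) v) = (E F ^ m) (ext0 F r s v) := by
  induction m with
  | zero => simp
  | succ m ih =>
    rw [pow_succ', Module.End.mul_apply, ext0_E, ih, pow_succ', Module.End.mul_apply]

lemma drop_le {V α : Type*} [AddCommGroup V] [Module F V] [FiniteDimensional F V] [Fintype α]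
    (T : Module.End F V) (m : ℕ) (φ : V →ₗ[F] (α → F))
    (h : ∀ u, (T ^ (m + 1)) u = 0 → φ ((T ^ m) u) = 0 → (T ^ m) u = 0) :
    Module.finrank F (LinearMap.range (T ^ m)) ≤
      Module.finrank F (LinearMap.range (T ^ (m + 1))) + Fintype.card α := by
  have hmem : ∀ x : LinearMap.range (T ^ m), T x.1 ∈ LinearMap.range (T ^ (m + 1)) := by
    rintro ⟨x, u, rfl⟩
    exact ⟨u, by rw [pow_succ', Module.End.mul_apply]⟩
  let ψ : LinearMap.range (T ^ m) →ₗ[F] (LinearMap.range (T ^ (m + 1)) × (α → F)) :=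
    LinearMap.prod ((T.comp (Submodule.subtype _)).codRestrict _ hmem)
      (φ.comp (Submodule.subtype _))
  have hψ : Function.Injective ψ := by
    rw [← LinearMap.ker_eq_bot, LinearMap.ker_eq_bot']
    rintro ⟨x, u, rfl⟩ hx
    have e1 : T ((T ^ m) u) = 0 := congrArg (fun y => (y.1 : V)) hx
    have e2 : φ ((T ^ m) u) = 0 := congrArg Prod.snd hx
    apply Subtype.ext
    exact h u (by rw [pow_succ', Module.End.mul_apply]; exact e1) e2
  have := LinearMap.finrank_le_finrank_of_injective hψ
  rwa [Module.finrank_prod, Module.finrank_fintype_fun_eq_card] at this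

lemma Epow_zero {r s : ℕ} {v : ℕ → ℕ → F} (h : Supp r s v) (m : ℕ) (a b : ℕ)
    (hab : r + s ≤ a + b + m + 1) : (E F ^ m) v a b = 0 := by
  induction m generalizing a b with
  | zero => exact h a b (by omega)
  | succ m ih =>
    rw [pow_succ', Module.End.mul_apply, E_apply, ih _ _ (by omega), ih _ _ (by omega), add_zero]

lemma sum_lam (r s : ℕ) (hrs : r ≤ s) : ∑ i : Fin r, (r + s - 1 - 2 * (i : ℕ)) = r * s := by
  rw [Fin.sum_univ_eq_sum_range (fun i => r + s - 1 - 2 * i) r]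
  have key : ∀ k, k ≤ r → ∑ i ∈ Finset.range k, (r + s - 1 - 2 * i) + k * k = k * (r + s) := by
    intro k
    induction k with
    | zero => simp
    | succ k ih =>
      intro hk
      rw [Finset.sum_range_succ]
      have := ih (by omega)
      have e : r + s - 1 - 2 * k + 2 * k + 1 = r + s := by omega
      nlinarith
  have := key r le_rfl
  nlinarith

lemma sum_drop (r m : ℕ) (lam : Fin r → ℕ) :
    ∑ i, (lam i - m) = ∑ i, (lam i - (m + 1)) + Fintype.card {i : Fin r // m < lam i} := by
  rw [Fintype.card_subtype, Finset.card_filter, ← Finset.sum_add_distrib]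
  apply Finset.sum_congr rfl
  intro i _
  split_ifs <;> omega

lemma rank_main (p : ℕ) [CharP F p] (hp : p.Prime) {r s q t : ℕ} (hst : s = q * p + t)
    (h1 : r ≤ t + 1) (h2 : r + t ≤ p + 1) (htp : t < p) (hrs : r ≤ s) (k : ℕ) :
    (EE F r s ^ k).rank = ∑ i : Fin r, (r + s - 1 - 2 * (i : ℕ) - k) := by
  set T := (EE F r s).mulVecLin with hT
  have hrank : ∀ m, (EE F r s ^ m).rank = Module.finrank F (LinearMap.range (T ^ m)) := by
    intro m
    have : (EE F r s ^ m).mulVecLin = T ^ m := by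
      induction m with
      | zero => simp [Module.End.one_eq_id]
      | succ m ih => rw [pow_succ, Matrix.mulVecLin_mul, ih, pow_succ]; rfl
    rw [Matrix.rank, this]
  let lam : Fin r → ℕ := fun i => r + s - 1 - 2 * (i : ℕ)
  have hd : ∀ m, (EE F r s ^ m).rank ≤
      (EE F r s ^ (m + 1)).rank + Fintype.card {i : Fin r // m < lam i} := by
    intro m
    rw [hrank, hrank]
    let φ : (Fin r × Fin s → F) →ₗ[F] ({i : Fin r // m < lam i} → F) :=
      { toFun := fun v i => ext0 F r s v i.1 0
        map_add' := by intro u v; ext i; simp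
        map_smul' := by intro c v; ext i; simp }
    apply drop_le T m φ
    intro u hu hφ
    apply ext0_inj r s
    rw [hT, ext0_Epow]
    apply string_zero p hp hst h1 h2 htp hrs m (ext0_supp r s u)
    · rw [← ext0_Epow, ← hT, hu, map_zero]
    · intro a ha hm
      have := congrFun hφ ⟨⟨a, ha⟩, hm⟩
      rw [← ext0_Epow]
      exact this
  have hstep : ∀ m, (EE F r s ^ m).rank + ∑ i, (lam i - (m + 1)) ≤
      (EE F r s ^ (m + 1)).rank + ∑ i, (lam i - m) := by
    intro m
    have := hd m
    have := sum_drop r m lam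
    omega
  have hup : ∀ m, ∀ n, (EE F r s ^ m).rank + ∑ i, (lam i - (m + n)) ≤
      (EE F r s ^ (m + n)).rank + ∑ i, (lam i - m) := by
    intro m n
    induction n with
    | zero => simp
    | succ n ih =>
      have := hstep (m + n)
      rw [← add_assoc]
      omega
  have a1 := hup 0 k
  have a2 := hup k (r + s)
  have b1 : (EE F r s ^ 0).rank = r * s := by
    rw [pow_zero, Matrix.rank_one]; simp
  have b2 : ∑ i, (lam i - 0) = r * s := sum_lam r s hrs
  have b3 : (EE F r s ^ (k + (r + s))).rank = 0 := by
    rw [hrank]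
    have : T ^ (k + (r + s)) = 0 := by
      ext1 v
      apply LinearMap.ext
      intro c
      apply ext0_inj r s
      simp only [LinearMap.comp_apply]
      rw [hT, ext0_Epow]
      ext a b
      exact Epow_zero (ext0_supp r s _) _ a b (by omega)
    rw [this]; simp
  rw [zero_add] at a1
  rw [b3] at a2
  show _ = ∑ i, (lam i - k)
  omega

end JP

/-- If `char F = p > 0` and `s ≢ 0, ±1, …, ±(r-2) (mod p)`, then the Jordan
partition of `J_r ⊗ J_s` is the standard partition `λ_i = r+s+1-2i`. -/
theorem stmt5 (F : Type*) [Field F] (p : ℕ) [CharP F p] (hp : p.Prime)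
    (r s : ℕ) (hr : 1 ≤ r) (hrs : r ≤ s)
    (hs : ∀ a : ℕ, a ≤ r - 2 → (s : ZMod p) ≠ (a : ZMod p) ∧ (s : ZMod p) ≠ -(a : ZMod p)) :
    IsJordanSeq (jordanBlock F r ⊗ₖ jordanBlock F s)
      (fun i : Fin r => r + s - 1 - 2 * (i : ℕ)) := by
  have := Fact.mk hp
  obtain ⟨q, t, hst, htp⟩ : ∃ q t, s = q * p + t ∧ t < p :=
    ⟨s / p, s % p, by rw [mul_comm]; exact (Nat.div_add_mod s p).symm, Nat.mod_lt _ hp.pos⟩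
  have hcast : (s : ZMod p) = (t : ZMod p) := by rw [hst]; simp
  have h1 : r ≤ t + 1 := by
    by_contra h
    exact (hs t (by omega)).1 hcast
  have h2 : r + t ≤ p + 1 := by
    by_contra h
    apply (hs (p - t) (by omega)).2
    rw [hcast, Nat.cast_sub htp.le]
    simp
  refine ⟨?_, ?_, ?_⟩
  · intro i j hij
    have : (i : ℕ) ≤ j := hij
    show r + s - 1 - 2 * (j : ℕ) ≤ r + s - 1 - 2 * (i : ℕ)
    omega
  · intro i
    have := i.2
    show 0 < r + s - 1 - 2 * (i : ℕ)
    omega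
  · intro k
    rw [JP.rank_eq]
    exact JP.rank_main p hp hst h1 h2 htp hrs k
end

section
/- Let F have characteristic p > 0, let m be such that r \u2264 p^m, and suppose r \u2264 s with s \u2261 0 (mod p^m). Then in A = F[X,Y]/(X^r,Y^s) one has (x+y)^s = 0, A decomposes as the direct sum \u2295_{i=0}^{r-1} x^i F[x+y], and x^i (x+y)^{s-1} \u2260 0 for all 0 \u2264 i < r. Consequently the Jordan partition \u03bb(r,s,p) is the uniform partition (s, s, \u2026, s). -/
open MvPolynomial

/-- The ideal `(X^r, Y^s)` in `F[X,Y]`. -/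
noncomputable def Irs (F : Type*) [Field F] (r s : ℕ) : Ideal (MvPolynomial (Fin 2) F) :=
  Ideal.span {(X 0 : MvPolynomial (Fin 2) F) ^ r, (X 1 : MvPolynomial (Fin 2) F) ^ s}

/-- The quotient algebra `A = F[X,Y]/(X^r, Y^s)`. -/
noncomputable abbrev Aq (F : Type*) [Field F] (r s : ℕ) :=
  MvPolynomial (Fin 2) F ⧸ Irs F r s

/-- The image `x` of `X` in `A`. -/
noncomputable def xq (F : Type*) [Field F] (r s : ℕ) : Aq F r s :=
  Ideal.Quotient.mk (Irs F r s) (X 0)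

/-- The image `y` of `Y` in `A`. -/
noncomputable def yq (F : Type*) [Field F] (r s : ℕ) : Aq F r s :=
  Ideal.Quotient.mk (Irs F r s) (X 1)

open Matrix Kronecker

/-- The cyclic `F[x+y]`-submodule `x^i F[x+y]` of `A`, as an `F`-submodule. -/
noncomputable def cycq (F : Type*) [Field F] (r s : ℕ) (i : ℕ) :
    Submodule F (Aq F r s) :=
  Submodule.span F (Set.range fun k : ℕ => xq F r s ^ i * (xq F r s + yq F r s) ^ k)

lemma aux_ker_comp {F V : Type*} [Field F] [AddCommGroup V] [Module F V] [FiniteDimensional F V]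
    (f g : V →ₗ[F] V) :
    Module.finrank F (LinearMap.ker (f ∘ₗ g)) ≤
      Module.finrank F (LinearMap.ker f) + Module.finrank F (LinearMap.ker g) := by
  have h := LinearMap.finrank_range_add_finrank_ker (g.domRestrict (LinearMap.ker (f ∘ₗ g)))
  have h1 : Module.finrank F (LinearMap.range (g.domRestrict (LinearMap.ker (f ∘ₗ g)))) ≤
      Module.finrank F (LinearMap.ker f) := by
    apply Submodule.finrank_mono
    rintro _ ⟨⟨x, hx⟩, rfl⟩
    simpa using hx
  have h2 : Module.finrank F (LinearMap.ker (g.domRestrict (LinearMap.ker (f ∘ₗ g)))) ≤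
      Module.finrank F (LinearMap.ker g) := by
    let φ : LinearMap.ker (g.domRestrict (LinearMap.ker (f ∘ₗ g))) →ₗ[F] LinearMap.ker g :=
      LinearMap.codRestrict _ ((Submodule.subtype _) ∘ₗ (Submodule.subtype _)) (by
        rintro ⟨⟨x, hx⟩, hx'⟩
        simpa using hx')
    apply LinearMap.finrank_le_finrank_of_injective (f := φ)
    intro a b hab
    have := congrArg Subtype.val hab
    exact Subtype.ext (Subtype.ext this)
  omega

lemma aux_ker_pow {F V : Type*} [Field F] [AddCommGroup V] [Module F V] [FiniteDimensional F V]
    (f : Module.End F V) (r : ℕ) (hf : Module.finrank F (LinearMap.ker f) ≤ r) (k : ℕ) :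
    Module.finrank F (LinearMap.ker (f ^ k)) ≤ k * r := by
  induction k with
  | zero =>
    have : LinearMap.ker (1 : Module.End F V) = ⊥ := LinearMap.ker_id
    simp [this]
  | succ k ih =>
    rw [pow_succ, Module.End.mul_eq_comp]
    have := aux_ker_comp (f ^ k) f
    rw [add_mul]
    omega

lemma aux_rank {F V : Type*} [Field F] [AddCommGroup V] [Module F V] [FiniteDimensional F V]
    (f : Module.End F V) (r s : ℕ) (hV : Module.finrank F V = r * s)
    (hf : Module.finrank F (LinearMap.ker f) ≤ r) (h0 : f ^ s = 0) (k : ℕ) :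
    Module.finrank F (LinearMap.range (f ^ k)) = r * (s - k) := by
  by_cases hk : s ≤ k
  · have : f ^ k = 0 := by
      rw [← Nat.add_sub_cancel' hk, pow_add, h0, zero_mul]
    rw [this, Nat.sub_eq_zero_of_le hk]
    simp
  · push Not at hk
    have h1 := aux_ker_pow f r hf k
    have h2 := aux_ker_pow f r hf (s - k)
    have h3 := aux_ker_comp (f ^ k) (f ^ (s - k))
    rw [← Module.End.mul_eq_comp, ← pow_add, Nat.add_sub_cancel' hk.le, h0,
      LinearMap.ker_zero, finrank_top, hV] at h3
    have h4 := LinearMap.finrank_range_add_finrank_ker (f ^ k)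
    obtain ⟨t, rfl⟩ := Nat.exists_eq_add_of_lt hk
    have e : k + t + 1 - k = t + 1 := by omega
    rw [e] at h2 h3 ⊢
    have e2 : r * (k + t + 1) = k * r + (t + 1) * r := by ring
    have e3 : r * (t + 1) = (t + 1) * r := by ring
    omega

lemma aux_nil (F : Type*) [Field F] (k : ℕ) : (jordanBlock F k - 1) ^ k = 0 := by
  have key : ∀ n : ℕ, ∀ i j : Fin k, (j : ℕ) < i + n → ((jordanBlock F k - 1) ^ n) i j = 0 := by
    intro n
    induction n with
    | zero =>
      intro i j h
      rw [pow_zero, Matrix.one_apply_ne]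
      rintro rfl
      omega
    | succ n ih =>
      intro i j h
      rw [pow_succ, Matrix.mul_apply]
      apply Finset.sum_eq_zero
      intro l _
      by_cases hl : (l : ℕ) < i + n
      · rw [ih _ _ hl, zero_mul]
      · have : (jordanBlock F k - 1) l j = 0 := by
          rw [Matrix.sub_apply, Matrix.one_apply, jordanBlock, Matrix.of_apply]
          by_cases hjl : j = l
          · simp [hjl]
          · rw [if_neg hjl, if_neg (by omega), if_neg (fun h => hjl h.symm), sub_zero]
        rw [this, mul_zero]
  ext i j
  exact key k i j (by omega)

lemma aux_kron_pow {F : Type*} [Field F] {a b : ℕ} (A : Matrix (Fin a) (Fin a) F)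
    (B : Matrix (Fin b) (Fin b) F) (n : ℕ) : (A ⊗ₖ B) ^ n = (A ^ n) ⊗ₖ (B ^ n) := by
  induction n with
  | zero => simp
  | succ n ih => rw [pow_succ, pow_succ, pow_succ, ih, Matrix.mul_kronecker_mul]

lemma aux_unip (F : Type*) [Field F] (p : ℕ) [CharP F p] (hp : p.Prime)
    (m r s : ℕ) (hr : 1 ≤ r) (hrpm : r ≤ p ^ m) (hrs : r ≤ s) (hdvd : p ^ m ∣ s) :
    (jordanBlock F r ⊗ₖ jordanBlock F s - 1) ^ s = 0 := by
  have hfact := Fact.mk hp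
  have hne1 : Nonempty (Fin r) := ⟨⟨0, hr⟩⟩
  have hne2 : Nonempty (Fin s) := ⟨⟨0, by omega⟩⟩
  obtain ⟨q, rfl⟩ := hdvd
  have h1 : jordanBlock F r ^ p ^ m = 1 := by
    have := sub_pow_expChar_pow_of_commute p m (Commute.one_right (jordanBlock F r))
    rw [one_pow, ← Nat.add_sub_cancel' hrpm, pow_add, aux_nil, zero_mul,
      Nat.add_sub_cancel' hrpm] at this
    exact (sub_eq_zero.mp this.symm)
  have h2 := sub_pow_expChar_pow_of_commute p m (Commute.one_right (jordanBlock F (p ^ m * q)))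
  have h3 := sub_pow_expChar_pow_of_commute p m
    (Commute.one_right (jordanBlock F r ⊗ₖ jordanBlock F (p ^ m * q)))
  rw [one_pow] at h2 h3
  rw [pow_mul, h3, aux_kron_pow, h1]
  have h4 : (1 : Matrix (Fin r) (Fin r) F) ⊗ₖ ((jordanBlock F (p ^ m * q)) ^ p ^ m) - 1 =
      1 ⊗ₖ ((jordanBlock F (p ^ m * q) - 1) ^ p ^ m) := by
    rw [h2, sub_eq_iff_eq_add]
    conv_rhs => rw [← Matrix.one_kronecker_one, ← Matrix.kronecker_add, sub_add_cancel]
  rw [h4, aux_kron_pow, ← pow_mul, aux_nil, Matrix.kronecker_zero]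

lemma aux_mulVec (F : Type*) [Field F] (r s : ℕ) (v : Fin r × Fin s → F)
    (i : Fin r) (j : ℕ) (hj : j + 1 < s) (h0 : ∀ i', v (i', ⟨j, by omega⟩) = 0)
    (h1 : ∀ i' : Fin r, i < i' → v (i', ⟨j + 1, hj⟩) = 0)
    (h : ((jordanBlock F r ⊗ₖ jordanBlock F s - 1) *ᵥ v) (i, ⟨j, by omega⟩) = 0) :
    v (i, ⟨j + 1, hj⟩) = 0 := by
  rw [Matrix.sub_mulVec, Matrix.one_mulVec, Pi.sub_apply, h0, sub_zero, Matrix.mulVec,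
    dotProduct, Finset.sum_eq_single (i, ⟨j + 1, hj⟩)] at h
  · simpa [jordanBlock, Matrix.kroneckerMap_apply] using h
  · rintro ⟨a, b⟩ _ hab
    rw [Matrix.kroneckerMap_apply]
    simp only [jordanBlock, Matrix.of_apply]
    by_cases hb : (b : ℕ) = j
    · have : b = ⟨j, by omega⟩ := Fin.ext hb
      rw [this, h0, mul_zero]
    by_cases hb' : (b : ℕ) = j + 1
    · have hbe : b = ⟨j + 1, by omega⟩ := Fin.ext hb'
      subst hbe
      by_cases ha : i < a
      · rw [h1 _ ha, mul_zero]
      · have hne : a ≠ i := by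
          rintro rfl
          exact hab rfl
        rw [if_neg hne, if_neg, zero_mul, zero_mul]
        intro hh
        apply ha
        rw [Fin.lt_def]
        omega
    · rw [if_neg (fun h : b = _ => hb (congrArg Fin.val h)), if_neg hb', mul_zero, zero_mul]
  · simp

lemma aux_kernel (F : Type*) [Field F] (r s : ℕ) (hs : 0 < s) :
    Module.finrank F (LinearMap.ker
      (Matrix.toLin' (jordanBlock F r ⊗ₖ jordanBlock F s - 1))) ≤ r := by
  let φ : (Fin r × Fin s → F) →ₗ[F] (Fin r → F) := LinearMap.funLeft F F (fun i => (i, ⟨0, hs⟩))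
  let ψ := φ.domRestrict (LinearMap.ker
      (Matrix.toLin' (jordanBlock F r ⊗ₖ jordanBlock F s - 1)))
  have hψ : Function.Injective ψ := by
    rw [injective_iff_map_eq_zero]
    rintro ⟨v, hv⟩ h
    rw [LinearMap.mem_ker, Matrix.toLin'_apply] at hv
    have h0 : ∀ i, v (i, ⟨0, hs⟩) = 0 := fun i => congrFun h i
    have key : ∀ j : ℕ, ∀ hj : j < s, ∀ i, v (i, ⟨j, hj⟩) = 0 := by
      intro j
      induction j with
      | zero => intro hj i; exact h0 i
      | succ j ih =>
        intro hj
        have hd : ∀ d : ℕ, ∀ i : Fin r, r - i ≤ d → v (i, ⟨j + 1, hj⟩) = 0 := by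
          intro d
          induction d with
          | zero => intro i hi; omega
          | succ d ihd =>
            intro i hi
            apply aux_mulVec F r s v i j hj (ih (by omega))
            · intro i' hi'
              rw [Fin.lt_def] at hi'
              exact ihd i' (by omega)
            · rw [hv]; rfl
        intro i
        exact hd _ i le_rfl
    apply Subtype.ext
    funext ⟨i, j⟩
    exact key j j.2 i
  have := LinearMap.finrank_le_finrank_of_injective hψ
  simpa using this

lemma aux_jordan (F : Type*) [Field F] (p : ℕ) [CharP F p] (hp : p.Prime)
    (m r s : ℕ) (hr : 1 ≤ r) (hrpm : r ≤ p ^ m) (hrs : r ≤ s) (hdvd : p ^ m ∣ s) :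
    IsJordanSeq (jordanBlock F r ⊗ₖ jordanBlock F s) (fun _ : Fin r => s) := by
  refine ⟨fun _ _ _ => le_rfl, fun _ => lt_of_lt_of_le hr hrs, fun k => ?_⟩
  rw [Matrix.rank, ← Matrix.toLin'_apply', Matrix.toLin'_pow]
  rw [aux_rank _ r s (by simp) (aux_kernel F r s (by omega)) ?_ k]
  · simp
  · rw [← Matrix.toLin'_pow, aux_unip F p hp m r s hr hrpm hrs hdvd, map_zero]

lemma aux_xr (F : Type*) [Field F] (r s : ℕ) : xq F r s ^ r = 0 := by
  rw [xq, ← map_pow, Ideal.Quotient.eq_zero_iff_mem]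
  exact Ideal.subset_span (by simp)

lemma aux_ys (F : Type*) [Field F] (r s : ℕ) : yq F r s ^ s = 0 := by
  rw [yq, ← map_pow, Ideal.Quotient.eq_zero_iff_mem]
  exact Ideal.subset_span (by simp)

lemma aux_coeff (F : Type*) [Field F] (r s : ℕ) (f : MvPolynomial (Fin 2) F)
    (hf : f ∈ Irs F r s) (d : Fin 2 →₀ ℕ) (h0 : d 0 < r) (h1 : d 1 < s) : f.coeff d = 0 := by
  rw [Irs, Ideal.mem_span_pair] at hf
  obtain ⟨a, b, rfl⟩ := hf
  rw [coeff_add, X_pow_eq_monomial, X_pow_eq_monomial, coeff_mul_monomial', coeff_mul_monomial',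
    if_neg, if_neg, add_zero]
  · intro h
    have := h 1
    simp at this
    omega
  · intro h
    have := h 0
    simp at this
    omega

lemma aux_li (F : Type*) [Field F] (r s : ℕ) : LinearIndependent F
    (fun ij : Fin r × Fin s => xq F r s ^ (ij.1 : ℕ) * yq F r s ^ (ij.2 : ℕ)) := by
  rw [Fintype.linearIndependent_iff]
  intro c hc ij
  let d : Fin r × Fin s → (Fin 2 →₀ ℕ) := fun ij =>
    Finsupp.single 0 (ij.1 : ℕ) + Finsupp.single 1 (ij.2 : ℕ)
  have hd : Function.Injective d := by
    rintro ⟨a, b⟩ ⟨a', b'⟩ h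
    have e0 := DFunLike.congr_fun h 0
    have e1 := DFunLike.congr_fun h 1
    simp [d] at e0 e1
    exact Prod.ext (Fin.ext e0) (Fin.ext e1)
  have hm : (∑ ij, monomial (d ij) (c ij)) ∈ Irs F r s := by
    rw [← Ideal.Quotient.eq_zero_iff_mem, map_sum, ← hc]
    apply Finset.sum_congr rfl
    intro ij _
    have : monomial (d ij) (c ij) = c ij • ((X 0 : MvPolynomial (Fin 2) F) ^ (ij.1 : ℕ) *
        (X 1 : MvPolynomial (Fin 2) F) ^ (ij.2 : ℕ)) := by
      rw [X_pow_eq_monomial, X_pow_eq_monomial, monomial_mul, smul_monomial]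
      simp [d]
    rw [this, xq, yq, ← map_pow, ← map_pow, ← map_mul]
    rfl
  have := aux_coeff F r s _ hm (d ij) (by simp [d]) (by simp [d])
  rw [coeff_sum] at this
  simp only [coeff_monomial] at this
  simpa [hd.eq_iff] using this

lemma aux_span (F : Type*) [Field F] (r s : ℕ) (hr : 1 ≤ r) :
    (⨆ i : Fin r, cycq F r s i) = ⊤ := by
  set S := ⨆ i : Fin r, cycq F r s i with hS
  have hmem : ∀ i k : ℕ, xq F r s ^ i * (xq F r s + yq F r s) ^ k ∈ S := by
    intro i k
    by_cases hi : i < r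
    · exact (le_iSup (fun i : Fin r => cycq F r s i) ⟨i, hi⟩)
        (Submodule.subset_span ⟨k, rfl⟩)
    · rw [← Nat.add_sub_cancel' (not_lt.mp hi), pow_add, aux_xr, zero_mul, zero_mul]
      exact S.zero_mem
  have hcl : ∀ z : Aq F r s,
      (∀ i k : ℕ, xq F r s ^ i * (xq F r s + yq F r s) ^ k * z ∈ S) → ∀ a ∈ S, a * z ∈ S := by
    intro z hz
    have : S ≤ S.comap (LinearMap.mulRight F z) := by
      conv_lhs => rw [hS]
      apply iSup_le
      intro i
      rw [cycq, Submodule.span_le]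
      rintro _ ⟨k, rfl⟩
      exact hz i k
    exact fun a ha => this ha
  have hx := hcl (xq F r s) (fun i k => by
    convert hmem (i + 1) k using 1
    ring)
  have hu := hcl (xq F r s + yq F r s) (fun i k => by
    convert hmem i (k + 1) using 1
    ring)
  have hy : ∀ a ∈ S, a * yq F r s ∈ S := by
    intro a ha
    have := S.sub_mem (hu a ha) (hx a ha)
    convert this using 1
    ring
  rw [eq_top_iff]
  intro a _
  obtain ⟨f, rfl⟩ := Ideal.Quotient.mk_surjective a
  induction f using MvPolynomial.induction_on with
  | C c =>
    have h1 := S.smul_mem c (hmem 0 0)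
    convert h1 using 1
    rw [pow_zero, pow_zero, one_mul, ← Algebra.algebraMap_eq_smul_one]
    rfl
  | add f g hf hg =>
    rw [map_add]
    exact S.add_mem (hf trivial) (hg trivial)
  | mul_X f i hf =>
    rw [map_mul]
    fin_cases i
    · exact hx _ (hf trivial)
    · exact hy _ (hf trivial)

lemma aux_charP (F : Type*) [Field F] (p : ℕ) [CharP F p] (r s : ℕ) (hr : 1 ≤ r) (hs : 1 ≤ s) :
    CharP (Aq F r s) p := by
  have h1 : (1 : Aq F r s) ≠ 0 := by
    have := (aux_li F r s).ne_zero (⟨0, hr⟩, ⟨0, hs⟩)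
    simpa using this
  have : Nontrivial (Aq F r s) := ⟨1, 0, h1⟩
  exact charP_of_injective_algebraMap (algebraMap F (Aq F r s)).injective p

lemma aux_us (F : Type*) [Field F] (p : ℕ) [CharP F p] (hp : p.Prime)
    (m r s : ℕ) (hr : 1 ≤ r) (hrpm : r ≤ p ^ m) (hrs : r ≤ s) (hdvd : p ^ m ∣ s) :
    (xq F r s + yq F r s) ^ s = 0 := by
  have hfact := Fact.mk hp
  have hch := aux_charP F p r s hr (hr.trans hrs)
  have hy := aux_ys F r s
  have hx : xq F r s ^ p ^ m = 0 := by
    rw [← Nat.add_sub_cancel' hrpm, pow_add, aux_xr, zero_mul]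
  have h := add_pow_char_pow (p := p) (n := m) (xq F r s) (yq F r s)
  rw [hx, zero_add] at h
  have h2 : ∀ n, p ^ m ∣ n → (xq F r s + yq F r s) ^ n = yq F r s ^ n := by
    rintro _ ⟨q, rfl⟩
    rw [pow_mul, h, pow_mul]
  rw [h2 s hdvd, hy]

lemma aux_cyc (F : Type*) [Field F] (r s : ℕ) (hu : (xq F r s + yq F r s) ^ s = 0) (i : Fin r) :
    cycq F r s i = Submodule.span F ((fun ij : Fin r × Fin s =>
      xq F r s ^ (ij.1 : ℕ) * (xq F r s + yq F r s) ^ (ij.2 : ℕ)) '' {ij | ij.1 = i}) := by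
  apply le_antisymm
  · rw [cycq, Submodule.span_le]
    rintro _ ⟨k, rfl⟩
    by_cases hk : k < s
    · exact Submodule.subset_span ⟨(i, ⟨k, hk⟩), rfl, rfl⟩
    · have : (xq F r s + yq F r s) ^ k = 0 := by
        rw [← Nat.add_sub_cancel' (not_lt.mp hk), pow_add, hu, zero_mul]
      simp [this]
  · apply Submodule.span_mono
    rintro _ ⟨⟨a, b⟩, rfl, rfl⟩
    exact ⟨b, rfl⟩

lemma aux_li2 (F : Type*) [Field F] (r s : ℕ) (hr : 1 ≤ r)
    (hu : (xq F r s + yq F r s) ^ s = 0) : LinearIndependent F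
    (fun ij : Fin r × Fin s =>
      xq F r s ^ (ij.1 : ℕ) * (xq F r s + yq F r s) ^ (ij.2 : ℕ)) := by
  have hspan : ⊤ ≤ Submodule.span F (Set.range (fun ij : Fin r × Fin s =>
      xq F r s ^ (ij.1 : ℕ) * (xq F r s + yq F r s) ^ (ij.2 : ℕ))) := by
    rw [← aux_span F r s hr]
    apply iSup_le
    intro i
    rw [aux_cyc F r s hu]
    exact Submodule.span_mono (Set.image_subset_range _ _)
  have hfin : Module.Finite F (Aq F r s) :=
    Module.finite_def.mpr ((top_le_iff.mp hspan) ▸ Submodule.fg_span (Set.finite_range _))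
  apply linearIndependent_of_top_le_span_of_card_eq_finrank hspan
  apply le_antisymm
  · exact (aux_li F r s).fintype_card_le_finrank
  · have := finrank_range_le_card (R := F) (fun ij : Fin r × Fin s =>
      xq F r s ^ (ij.1 : ℕ) * (xq F r s + yq F r s) ^ (ij.2 : ℕ))
    rw [Set.finrank, top_le_iff.mp hspan, finrank_top] at this
    exact this


/-- If `r ≤ p^m` and `p^m ∣ s`, then `(x+y)^s = 0`,
`A = ⊕_{i=0}^{r-1} x^i F[x+y]`, each `x^i (x+y)^{s-1} ≠ 0`, and the Jordan
partition of `J_r ⊗ J_s` is uniform: `(s, …, s)`. -/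
theorem stmt9 (F : Type*) [Field F] (p : ℕ) [CharP F p] (hp : p.Prime)
    (m r s : ℕ) (hr : 1 ≤ r) (hrpm : r ≤ p ^ m) (hrs : r ≤ s) (hdvd : p ^ m ∣ s) :
    (xq F r s + yq F r s) ^ s = 0 ∧
    (⨆ i : Fin r, cycq F r s i) = ⊤ ∧
    iSupIndep (fun i : Fin r => cycq F r s i) ∧
    (∀ i : Fin r, xq F r s ^ (i : ℕ) * (xq F r s + yq F r s) ^ (s - 1) ≠ 0) ∧
    IsJordanSeq (jordanBlock F r ⊗ₖ jordanBlock F s) (fun _ : Fin r => s) := by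
  have hu := aux_us F p hp m r s hr hrpm hrs hdvd
  have hli := aux_li2 F r s hr hu
  refine ⟨hu, aux_span F r s hr, ?_, ?_, aux_jordan F p hp m r s hr hrpm hrs hdvd⟩
  · intro i
    have hd : Disjoint {ij : Fin r × Fin s | ij.1 = i} {ij : Fin r × Fin s | ij.1 ≠ i} := by
      rw [Set.disjoint_left]
      intro a ha hb
      exact hb ha
    have h := hli.disjoint_span_image hd
    rw [← aux_cyc F r s hu i] at h
    refine h.mono_right ?_
    apply iSup_le
    intro j
    apply iSup_le
    intro hj
    refine (aux_cyc F r s hu j).le.trans ?_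
    apply Submodule.span_mono
    apply Set.image_mono
    rintro ⟨a, b⟩ rfl
    exact hj
  · intro i
    have hs : s - 1 < s := by omega
    have h := hli.ne_zero (i, ⟨s - 1, hs⟩)
    simpa only [] using h
end

section
/- If 1 \u2264 r \u2264 s and \u03b5(r,s,p) = (\u03b5_1, \u2026, \u03b5_r) is the deviation vector of the Jordan partition of J_r \u2297 J_s, then |\u03b5_i| \u2264 r-1 for all 1 \u2264 i \u2264 r; equivalently, every part \u03bb_i of \u03bb(r,s,p) satisfies s-(r-1) \u2264 \u03bb_i \u2264 s+(r-1). -/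
open Matrix Kronecker

lemma aux_comm {R : Type*} [CommRing R] (x y : R) (m k : ℕ) (hx : x ^ (m + 1) = 0)
    (hy : y ^ (k + m) = 0) : ∃ z, (x + y + x * y) ^ k * (y ^ m + x * z) = 0 := by
  obtain ⟨n, hn⟩ : ∃ n, n = x + y + x * y := ⟨_, rfl⟩
  rw [← hn]
  have h1 : ((-x) + n) ^ (k + m) = 0 := by
    have : -x + n = y * (1 + x) := by rw [hn]; ring
    rw [this, mul_pow, hy, zero_mul]
  have h2 : ((-x) + n) ^ (k + m) = n ^ k * ∑ j ∈ Finset.range (m + 1),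
      (-x) ^ j * n ^ (m - j) * ((k + m).choose j : R) := by
    rw [add_pow, show k + m + 1 = (m + 1) + k by ring, Finset.sum_range_add, Finset.mul_sum]
    rw [Finset.sum_eq_zero (s := Finset.range k), add_zero]
    · apply Finset.sum_congr rfl
      intro j hj
      have hj' : j ≤ m := by simpa [Nat.lt_succ_iff] using hj
      rw [show k + m - j = k + (m - j) by omega, pow_add]
      ring
    · intro j _
      have : (-x) ^ (m + 1 + j) = 0 := by rw [pow_add, neg_pow x (m + 1), hx]; simp
      rw [this]; simp
  rw [h1, Finset.sum_range_succ'] at h2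
  obtain ⟨d, hd⟩ := sub_dvd_pow_sub_pow n y m
  have hd' : n ^ m = y ^ m + x * ((1 + y) * d) := by
    have : n - y = x * (1 + y) := by rw [hn]; ring
    rw [this] at hd
    linear_combination hd
  refine ⟨(1 + y) * d - ∑ j ∈ Finset.range m,
      (-x) ^ j * n ^ (m - (j + 1)) * ((k + m).choose (j + 1) : R), ?_⟩
  have h3 : ∑ j ∈ Finset.range m, (-x) ^ (j + 1) * n ^ (m - (j + 1)) *
      ((k + m).choose (j + 1) : R) = -x * ∑ j ∈ Finset.range m,
      (-x) ^ j * n ^ (m - (j + 1)) * ((k + m).choose (j + 1) : R) := by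
    rw [Finset.mul_sum]
    apply Finset.sum_congr rfl
    intro j _
    ring
  rw [h3] at h2
  simp only [pow_zero, one_mul, Nat.sub_zero, Nat.choose_zero_right, Nat.cast_one, mul_one] at h2
  rw [hd'] at h2
  linear_combination -h2

lemma aux_ring {F A : Type*} [Field F] [Ring A] [Algebra F A] (x y : A) (hxy : x * y = y * x)
    (m k : ℕ) (hx : x ^ (m + 1) = 0) (hy : y ^ (k + m) = 0) :
    ∃ z, x * z = z * x ∧ (x + y + x * y) ^ k * (y ^ m + x * z) = 0 := by
  letI : CommRing (Algebra.adjoin F {x, y}) := Algebra.adjoinCommRingOfComm F (by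
    rintro a (rfl | rfl) b (rfl | rfl) <;> simp [hxy])
  have hxm : x ∈ Algebra.adjoin F {x, y} := Algebra.subset_adjoin (by simp)
  have hym : y ∈ Algebra.adjoin F {x, y} := Algebra.subset_adjoin (by simp)
  obtain ⟨z, hz⟩ := aux_comm (⟨x, hxm⟩ : Algebra.adjoin F {x, y}) ⟨y, hym⟩ m k
    (Subtype.ext hx) (Subtype.ext hy)
  refine ⟨z.1, ?_, congrArg Subtype.val hz⟩
  exact congrArg Subtype.val (mul_comm (⟨x, hxm⟩ : Algebra.adjoin F {x, y}) z)

lemma nil_pow_apply (F : Type*) [Field F] (r t : ℕ) (i j : Fin r) :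
    ((jordanBlock F r - 1) ^ t) i j = if (j : ℕ) = i + t then 1 else 0 := by
  induction t generalizing i j with
  | zero => simp [Matrix.one_apply, Fin.ext_iff, eq_comm]
  | succ t ih =>
    rw [pow_succ, Matrix.mul_apply]
    have hb : ∀ a b : Fin r, (jordanBlock F r - 1) a b = if (b : ℕ) = a + 1 then 1 else 0 := by
      intro a b
      simp only [jordanBlock, Matrix.sub_apply, Matrix.of_apply, Matrix.one_apply, Fin.ext_iff]
      grind
    simp only [ih, hb]
    by_cases h : (j : ℕ) = i + (t + 1)
    · rw [if_pos h, Finset.sum_eq_single (⟨i + t, by omega⟩ : Fin r)]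
      · simp; omega
      · intro b _ hb
        have : (b : ℕ) ≠ i + t := fun h => hb (Fin.ext h)
        simp [this]
      · simp
    · rw [if_neg h]
      apply Finset.sum_eq_zero
      intro b _
      by_cases h1 : (b : ℕ) = i + t
      · rw [if_neg (show ¬ (j : ℕ) = b + 1 by omega), mul_zero]
      · rw [if_neg h1, zero_mul]

lemma nil_pow_eq_zero (F : Type*) [Field F] (r : ℕ) : (jordanBlock F r - 1) ^ r = 0 := by
  ext i j
  rw [nil_pow_apply, if_neg (by omega), Matrix.zero_apply]

lemma split_one (F : Type*) [Field F] (s m : ℕ) :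
    (1 : Matrix (Fin s) (Fin s) F) =
      Matrix.diagonal (fun j : Fin s => if s ≤ j + m then 1 else 0) +
      (jordanBlock F s - 1) ^ m *
        Matrix.of (fun i j : Fin s => if (i : ℕ) = j + m then 1 else 0) := by
  ext i j
  rw [Matrix.add_apply, Matrix.mul_apply]
  simp only [nil_pow_apply, Matrix.of_apply, Matrix.one_apply, Matrix.diagonal_apply]
  by_cases h : (i : ℕ) + m < s
  · rw [Finset.sum_eq_single (⟨i + m, h⟩ : Fin s)]
    · simp only [Fin.ext_iff]
      grind
    · intro b _ hb
      have : (b : ℕ) ≠ i + m := fun h => hb (Fin.ext h)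
      simp [this]
    · simp
  · rw [Finset.sum_eq_zero]
    · simp only [Fin.ext_iff]
      grind
    · intro b _
      rw [if_neg (by omega), zero_mul]

lemma rank_proj (F : Type*) [Field F] (r s m : ℕ) :
    ((1 : Matrix (Fin r) (Fin r) F) ⊗ₖ
      Matrix.diagonal (fun j : Fin s => if s ≤ j + m then (1 : F) else 0)).rank ≤ r * m := by
  classical
  rw [← Matrix.diagonal_one, Matrix.diagonal_kronecker_diagonal, Matrix.rank_diagonal]
  have key : ∀ q : {q : Fin r × Fin s // (1 : F) * (if s ≤ q.2 + m then (1 : F) else 0) ≠ 0},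
      s ≤ q.1.2 + m := by
    intro q
    by_contra h
    exact q.2 (by rw [if_neg h, mul_zero])
  let f : {q : Fin r × Fin s // (1 : F) * (if s ≤ q.2 + m then (1 : F) else 0) ≠ 0} →
      Fin r × Fin m := fun q => (q.1.1, ⟨s - 1 - q.1.2, by
        have := key q; have := q.1.2.2; omega⟩)
  have hf : Function.Injective f := by
    intro a b hab
    have h1 : a.1.1 = b.1.1 := congrArg (fun q : Fin r × Fin m => q.1) hab
    have h2 : s - 1 - (a.1.2 : ℕ) = s - 1 - b.1.2 := congrArg (fun q : Fin r × Fin m => (q.2 : ℕ)) hab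
    have := a.1.2.2
    have := b.1.2.2
    exact Subtype.ext (Prod.ext h1 (Fin.ext (by omega)))
  simpa using Fintype.card_le_of_injective f hf

lemma kron_pow_left {F : Type*} [Field F] {r s : ℕ} (a : Matrix (Fin r) (Fin r) F) (t : ℕ) :
    (a ⊗ₖ (1 : Matrix (Fin s) (Fin s) F)) ^ t = (a ^ t) ⊗ₖ 1 := by
  induction t with
  | zero => simp
  | succ t ih => rw [pow_succ, ih, ← Matrix.mul_kronecker_mul, pow_succ, one_mul]

lemma kron_pow_right {F : Type*} [Field F] {r s : ℕ} (a : Matrix (Fin s) (Fin s) F) (t : ℕ) :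
    ((1 : Matrix (Fin r) (Fin r) F) ⊗ₖ a) ^ t = 1 ⊗ₖ (a ^ t) := by
  induction t with
  | zero => simp
  | succ t ih => rw [pow_succ, ih, ← Matrix.mul_kronecker_mul, pow_succ, one_mul]

lemma decomp (F : Type*) [Field F] (m k : ℕ) :
    (((jordanBlock F (m + 1) ⊗ₖ jordanBlock F (k + m)) - 1) ^ (k + m + m) = 0) ∧
    (((jordanBlock F (m + 1) ⊗ₖ jordanBlock F (k + m)) - 1) ^ k).rank ≤ (m + 1) * m := by
  obtain ⟨a, ha⟩ : ∃ a, a = jordanBlock F (m + 1) - 1 := ⟨_, rfl⟩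
  obtain ⟨b, hb⟩ : ∃ b, b = jordanBlock F (k + m) - 1 := ⟨_, rfl⟩
  have hax : a ^ (m + 1) = 0 := ha ▸ nil_pow_eq_zero F (m + 1)
  have hbx : b ^ (k + m) = 0 := hb ▸ nil_pow_eq_zero F (k + m)
  have hsp := split_one F (k + m) m
  rw [← hb] at hsp
  have hrk := rank_proj F (m + 1) (k + m) m
  generalize Matrix.diagonal (fun j : Fin (k + m) => if k + m ≤ j + m then (1 : F) else 0) = D
    at hsp hrk
  generalize Matrix.of (fun i j : Fin (k + m) => if (i : ℕ) = j + m then (1 : F) else 0) = E at hsp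
  have hN : (jordanBlock F (m + 1) ⊗ₖ jordanBlock F (k + m)) - 1 =
      a ⊗ₖ 1 + 1 ⊗ₖ b + (a ⊗ₖ 1) * (1 ⊗ₖ b) := by
    have h1 : jordanBlock F (m + 1) = a + 1 := by rw [ha]; abel
    have h2 : jordanBlock F (k + m) = b + 1 := by rw [hb]; abel
    rw [h1, h2, ← Matrix.mul_kronecker_mul, Matrix.add_kronecker, Matrix.kronecker_add,
      Matrix.kronecker_add, Matrix.one_kronecker_one, mul_one, one_mul]
    abel
  have hcomm : ∀ c, (a ⊗ₖ 1) * ((1 : Matrix (Fin (m + 1)) (Fin (m + 1)) F) ⊗ₖ c) =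
      (1 ⊗ₖ c) * (a ⊗ₖ (1 : Matrix (Fin (k + m)) (Fin (k + m)) F)) := by
    intro c
    rw [← Matrix.mul_kronecker_mul, ← Matrix.mul_kronecker_mul]
    simp
  rw [hN]
  have hX : (a ⊗ₖ (1 : Matrix (Fin (k + m)) (Fin (k + m)) F)) ^ (m + 1) = 0 := by
    rw [kron_pow_left, hax, Matrix.zero_kronecker]
  have hY : ((1 : Matrix (Fin (m + 1)) (Fin (m + 1)) F) ⊗ₖ b) ^ (k + m) = 0 := by
    rw [kron_pow_right, hbx, Matrix.kronecker_zero]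
  have hone : 1 = (1 : Matrix (Fin (m + 1)) (Fin (m + 1)) F) ⊗ₖ D +
      (1 ⊗ₖ b) ^ m * (1 ⊗ₖ E) := by
    rw [kron_pow_right, ← Matrix.mul_kronecker_mul, one_mul, ← Matrix.kronecker_add, ← hsp,
      Matrix.one_kronecker_one]
  have hXY := hcomm b
  have hXT := hcomm E
  generalize a ⊗ₖ (1 : Matrix (Fin (k + m)) (Fin (k + m)) F) = X at *
  generalize (1 : Matrix (Fin (m + 1)) (Fin (m + 1)) F) ⊗ₖ b = Y at *
  generalize (1 : Matrix (Fin (m + 1)) (Fin (m + 1)) F) ⊗ₖ D = P at *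
  generalize (1 : Matrix (Fin (m + 1)) (Fin (m + 1)) F) ⊗ₖ E = T at *
  constructor
  · have e : X + Y + X * Y = X * (1 + Y) + Y := by rw [mul_add, mul_one]; abel
    have hc : Commute X (1 + Y) := (Commute.one_right X).add_right hXY
    have hc' : Commute (X * (1 + Y)) Y :=
      Commute.mul_left hXY ((Commute.one_left Y).add_left (Commute.refl Y))
    rw [e]
    refine hc'.add_pow_eq_zero_of_add_le_succ_of_pow_eq_zero (m := m + 1) (n := k + m) ?_ hY
      (by omega)
    rw [hc.mul_pow, hX, zero_mul]
  · obtain ⟨z, hz, hQ⟩ := aux_ring (F := F) X Y hXY m k hX hY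
    generalize (X + Y + X * Y) ^ k = M at *
    have hu : IsUnit (1 + X * (z * T)) := by
      have hc : Commute X (z * T) := Commute.mul_right hz hXT
      exact IsNilpotent.isUnit_one_add (hc.isNilpotent_mul_right ⟨_, hX⟩)
    have hMP : M * (1 + X * (z * T)) = M * P := by
      have : 1 + X * (z * T) = P + (Y ^ m + X * z) * T := by
        conv_lhs => rw [hone]
        noncomm_ring
      rw [this, mul_add, ← mul_assoc, hQ, zero_mul, add_zero]
    rw [← Matrix.rank_mul_eq_left_of_isUnit_det _ M ((Matrix.isUnit_iff_isUnit_det _).1 hu), hMP]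
    exact (Matrix.rank_mul_le_right M P).trans hrk

/-- Every part of the Jordan partition of `J_r ⊗ J_s` satisfies
`s - (r-1) ≤ λ_i ≤ s + (r-1)`, i.e. `|ε_i| ≤ r - 1`. -/
theorem stmt16 (F : Type*) [Field F] (r s : ℕ) (hr : 1 ≤ r) (hrs : r ≤ s)
    (lam : Fin r → ℕ)
    (hlam : IsJordanSeq (jordanBlock F r ⊗ₖ jordanBlock F s) lam) :
    ∀ i : Fin r, s - (r - 1) ≤ lam i ∧ lam i ≤ s + (r - 1) := by
  obtain ⟨m, rfl⟩ : ∃ m, r = m + 1 := ⟨r - 1, by omega⟩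
  obtain ⟨k, rfl⟩ : ∃ k, s = k + m := ⟨s - m, by omega⟩
  obtain ⟨-, -, hrank⟩ := hlam
  obtain ⟨h1, h2⟩ := decomp F m k
  have h0 := hrank 0
  rw [pow_zero, Matrix.rank_one] at h0
  simp only [Fintype.card_prod, Fintype.card_fin, Nat.sub_zero] at h0
  have hup := hrank (k + m + m)
  rw [h1, Matrix.rank_zero] at hup
  rw [hrank k] at h2
  intro i
  constructor
  · by_contra hlt
    have hs : ∑ i, lam i < ∑ i, ((lam i - k) + k) :=
      Finset.sum_lt_sum (fun j _ => by omega) ⟨i, Finset.mem_univ i, by omega⟩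
    rw [Finset.sum_add_distrib, ← h0] at hs
    simp only [Finset.sum_const, Finset.card_univ, Fintype.card_fin, smul_eq_mul] at hs
    have : (m + 1) * (k + m) = (m + 1) * m + (m + 1) * k := by ring
    omega
  · have := (Finset.sum_eq_zero_iff.1 hup.symm) i (Finset.mem_univ i)
    omega
end

section
/- Let char F = p > 0 and r \u2264 min{s, p^m} with p^{m-1} < r \u2264 p^m. If s \u2261 1 (mod p^m), then \u03b5(r,s,p) = (r-1, -1, \u2026, -1); equivalently, \u03bb(r,s,p) = (s+r-1, s-1, \u2026, s-1). Dually, if s \u2261 -1 (mod p^m), then \u03b5(r,s,p) = (1, \u2026, 1, -(r-1)). -/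
open Matrix Kronecker

/-- The `k`-th shift matrix. -/
def shiftMat (F : Type*) [Zero F] [One F] (n k : ℕ) : Matrix (Fin n) (Fin n) F :=
  Matrix.of fun i j => if (j : ℕ) = (i : ℕ) + k then 1 else 0

theorem shiftMat_zero (F : Type*) [Field F] (n : ℕ) : shiftMat F n 0 = 1 := by
  ext i j
  simp only [shiftMat, Matrix.of_apply, Matrix.one_apply, add_zero, Fin.ext_iff, eq_comm]

theorem shiftMat_mul_apply (F : Type*) [Field F] (n k : ℕ) (B : Matrix (Fin n) (Fin n) F)
    (i j : Fin n) : (shiftMat F n k * B) i j =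
      if h : (i : ℕ) + k < n then B ⟨i + k, h⟩ j else 0 := by
  rw [Matrix.mul_apply]
  split_ifs with h
  · rw [Finset.sum_eq_single ⟨i + k, h⟩]
    · simp [shiftMat]
    · intro b _ hb
      have : (b : ℕ) ≠ i + k := fun e => hb (Fin.ext e)
      simp [shiftMat, this]
    · simp
  · apply Finset.sum_eq_zero
    intro b _
    have : (b : ℕ) ≠ i + k := by have := b.2; omega
    simp [shiftMat, this]

theorem shiftMat_mul (F : Type*) [Field F] (n k l : ℕ) :
    shiftMat F n k * shiftMat F n l = shiftMat F n (k + l) := by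
  ext i j
  rw [shiftMat_mul_apply]
  have := j.2
  simp only [shiftMat, Matrix.of_apply]
  split_ifs <;> first | rfl | omega

theorem shiftMat_pow (F : Type*) [Field F] (n k : ℕ) :
    shiftMat F n 1 ^ k = shiftMat F n k := by
  induction k with
  | zero => rw [pow_zero, shiftMat_zero]
  | succ k ih => rw [pow_succ, ih, shiftMat_mul]

theorem shiftMat_eq_zero (F : Type*) [Field F] (n k : ℕ) (h : n ≤ k) :
    shiftMat F n k = 0 := by
  ext i j
  have := j.2
  simp only [shiftMat, Matrix.of_apply, Matrix.zero_apply]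
  rw [if_neg (by omega)]

theorem jordanBlock_eq (F : Type*) [Field F] (n : ℕ) :
    jordanBlock F n = shiftMat F n 1 + 1 := by
  ext i j
  simp only [jordanBlock, shiftMat, Matrix.of_apply, Matrix.add_apply, Matrix.one_apply,
    Fin.ext_iff]
  split_ifs <;> first | omega | simp

theorem kron_pow {F : Type*} [Field F] {a b : ℕ} (A : Matrix (Fin a) (Fin a) F)
    (B : Matrix (Fin b) (Fin b) F) (k : ℕ) : (A ⊗ₖ B) ^ k = (A ^ k) ⊗ₖ (B ^ k) := by
  induction k with
  | zero => simp
  | succ k ih => rw [pow_succ, ih, pow_succ, pow_succ, Matrix.mul_kronecker_mul]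

theorem kron_sub_one (F : Type*) [Field F] (r s : ℕ) :
    jordanBlock F r ⊗ₖ jordanBlock F s - 1 =
      shiftMat F r 1 ⊗ₖ 1 + jordanBlock F r ⊗ₖ shiftMat F s 1 := by
  conv_lhs => rw [jordanBlock_eq F s, Matrix.kronecker_add]
  conv_lhs => rw [jordanBlock_eq F r, Matrix.add_kronecker _ _ (1 : Matrix (Fin s) (Fin s) F),
    Matrix.one_kronecker_one, ← jordanBlock_eq F r]
  abel

theorem comm_XY (F : Type*) [Field F] (r s : ℕ) :
    Commute (shiftMat F r 1 ⊗ₖ (1 : Matrix (Fin s) (Fin s) F))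
      (jordanBlock F r ⊗ₖ shiftMat F s 1) := by
  unfold Commute SemiconjBy
  rw [← Matrix.mul_kronecker_mul, ← Matrix.mul_kronecker_mul, jordanBlock_eq]
  simp [mul_add, add_mul]

theorem jordanBlock_pow_q (F : Type*) [Field F] (p : ℕ) [CharP F p] (hp : p.Prime)
    (m r : ℕ) (hr : 0 < r) (hrpm : r ≤ p ^ m) : jordanBlock F r ^ (p ^ m) = 1 := by
  have : Fact p.Prime := ⟨hp⟩
  have : Nonempty (Fin r) := ⟨⟨0, hr⟩⟩
  rw [jordanBlock_eq, add_pow_char_pow_of_commute p m (Commute.one_right _), shiftMat_pow,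
    shiftMat_eq_zero F r _ hrpm, one_pow, zero_add]

theorem N_pow_mul_q (F : Type*) [Field F] (p : ℕ) [CharP F p] (hp : p.Prime)
    (m r s a : ℕ) (hr : 0 < r) (hs : 0 < s) (hrpm : r ≤ p ^ m) :
    (jordanBlock F r ⊗ₖ jordanBlock F s - 1) ^ (p ^ m * a) = 1 ⊗ₖ shiftMat F s (p ^ m * a) := by
  have : Fact p.Prime := ⟨hp⟩
  have : Nonempty (Fin r) := ⟨⟨0, hr⟩⟩
  have : Nonempty (Fin s) := ⟨⟨0, hs⟩⟩
  rw [pow_mul, kron_sub_one, add_pow_char_pow_of_commute p m (comm_XY F r s), kron_pow, kron_pow,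
    jordanBlock_pow_q F p hp m r hr hrpm, shiftMat_pow, shiftMat_eq_zero F r _ hrpm,
    Matrix.zero_kronecker, zero_add, kron_pow, one_pow, ← pow_mul, shiftMat_pow]

theorem top_mul_pow (F : Type*) [Field F] (r s j : ℕ) (hs : 0 < s) :
    (1 : Matrix (Fin r) (Fin r) F) ⊗ₖ shiftMat F s (s - 1) *
      (jordanBlock F r ⊗ₖ jordanBlock F s - 1) ^ j = shiftMat F r j ⊗ₖ shiftMat F s (s - 1) := by
  induction j with
  | zero => rw [pow_zero, mul_one, shiftMat_zero]
  | succ j ih =>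
    rw [pow_succ, ← mul_assoc, ih, kron_sub_one, mul_add, ← Matrix.mul_kronecker_mul,
      ← Matrix.mul_kronecker_mul, shiftMat_mul, shiftMat_mul, mul_one,
      shiftMat_eq_zero F s (s - 1 + 1) (by omega), Matrix.kronecker_zero, add_zero]

theorem rank_top_le (F : Type*) [Field F] (r s : ℕ) (hs : 0 < s) :
    ((1 : Matrix (Fin r) (Fin r) F) ⊗ₖ shiftMat F s (s - 1)).rank ≤ r := by
  have h := Matrix.rank_le_card_of_support_subset
    ((1 : Matrix (Fin r) (Fin r) F) ⊗ₖ shiftMat F s (s - 1))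
    (Finset.univ ×ˢ {(⟨0, hs⟩ : Fin s)}) (by
      rw [Function.support_subset_iff']
      rintro ⟨i, i'⟩ hi
      have hi' : (i' : ℕ) ≠ 0 := by
        intro e
        apply hi
        simp [Fin.ext_iff, e]
      ext ⟨j, j'⟩
      have := j'.2
      simp only [Matrix.row, Matrix.kronecker_apply, shiftMat, Matrix.of_apply, Pi.zero_apply]
      rw [if_neg (by omega), mul_zero])
  simpa using h

theorem rank_pos_of_ne {F : Type*} [Field F] {n : Type*} [Fintype n] [DecidableEq n]
    (A : Matrix n n F) (i j : n) (h : A i j ≠ 0) : 0 < A.rank := by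
  have h1 := Matrix.rank_submatrix_le A (fun _ : Fin 1 => i) (fun _ : Fin 1 => j)
  rw [Matrix.rank_of_det_ne_zero (by simpa using h)] at h1
  rw [Fintype.card_fin] at h1
  exact h1

theorem jordanBlock_pow_last (F : Type*) [Field F] (r n : ℕ) (l : Fin r) (hl : (l : ℕ) + 1 = r) :
    (jordanBlock F r ^ n) l l = 1 := by
  induction n with
  | zero => simp
  | succ n ih =>
    rw [pow_succ', jordanBlock_eq, add_mul, Matrix.add_apply, shiftMat_mul_apply,
      dif_neg (by omega), one_mul, ← jordanBlock_eq, ih, zero_add]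

theorem choose_cast_ne_zero (F : Type*) [Field F] (p : ℕ) [CharP F p] (hp : p.Prime)
    (m s : ℕ) (h : p ^ m ∣ s + 1) (k : ℕ) (hk : k < p ^ m) : ((s.choose k : ℕ) : F) = (-1) ^ k := by
  induction k with
  | zero => simp
  | succ k ih =>
    have h1 : p ∣ (s + 1).choose (k + 1) := by
      by_contra hc
      have h2 : p ^ m ∣ (s + 1).choose (k + 1) * (k + 1) := by
        rw [← Nat.add_one_mul_choose_eq]
        exact h.mul_right _
      have h3 := Nat.Coprime.dvd_of_dvd_mul_left
        (((Nat.Prime.coprime_iff_not_dvd hp).2 hc).pow_left m) h2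
      have := Nat.le_of_dvd (by omega) h3
      omega
    have h4 := (CharP.cast_eq_zero_iff F p _).2 h1
    rw [Nat.choose_succ_succ, Nat.cast_add, ih (by omega)] at h4
    rw [pow_succ]
    linear_combination h4

theorem N_pow_entry (F : Type*) [Field F] (r s a b : ℕ) (ha : a < r) (hb : b + 1 ≤ s)
    (hs : 0 < s) (l : Fin r) :
    ((jordanBlock F r ⊗ₖ jordanBlock F s - 1) ^ s) (⟨a, ha⟩, ⟨0, hs⟩) (l, ⟨s - 1 - b, by omega⟩) =
      (shiftMat F r (b + 1) * jordanBlock F r ^ (s - (b + 1))) ⟨a, ha⟩ l * (s.choose (b + 1) : F) := by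
  rw [kron_sub_one, (comm_XY F r s).add_pow, Matrix.sum_apply,
    Finset.sum_eq_single (b + 1)]
  · rw [kron_pow, kron_pow, one_pow, ← Matrix.mul_kronecker_mul, one_mul, shiftMat_pow,
      shiftMat_pow, ← nsmul_eq_mul', Matrix.smul_apply, nsmul_eq_mul', Matrix.kronecker_apply]
    have : shiftMat F s (s - (b + 1)) ⟨0, hs⟩ ⟨s - 1 - b, by omega⟩ = 1 := by
      simp only [shiftMat, Matrix.of_apply]
      rw [if_pos (by omega)]
    rw [this, mul_one]
  · intro k hk hkb
    rw [Finset.mem_range] at hk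
    rw [kron_pow, kron_pow, one_pow, ← Matrix.mul_kronecker_mul, one_mul, shiftMat_pow,
      shiftMat_pow, ← nsmul_eq_mul', Matrix.smul_apply, nsmul_eq_mul', Matrix.kronecker_apply]
    have : shiftMat F s (s - k) ⟨0, hs⟩ ⟨s - 1 - b, by omega⟩ = 0 := by
      simp only [shiftMat, Matrix.of_apply]
      rw [if_neg (by omega)]
    rw [this, mul_zero, zero_mul]
  · intro h
    simp at h
    omega

theorem rank_N_pow_ge (F : Type*) [Field F] (p : ℕ) [CharP F p] (hp : p.Prime)
    (m r s : ℕ) (hr : 2 ≤ r) (hrpm : r ≤ p ^ m) (hrs : r ≤ s) (h : p ^ m ∣ s + 1) :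
    r - 1 ≤ ((jordanBlock F r ⊗ₖ jordanBlock F s - 1) ^ s).rank := by
  set A := (jordanBlock F r ⊗ₖ jordanBlock F s - 1) ^ s with hA
  let f : Fin (r - 1) → Fin r × Fin s := fun i => (⟨r - 2 - i, by omega⟩, ⟨0, by omega⟩)
  let g : Fin (r - 1) → Fin r × Fin s := fun j => (⟨r - 1, by omega⟩, ⟨s - 1 - j, by omega⟩)
  have h1 := Matrix.rank_submatrix_le A f g
  have hent : ∀ i j : Fin (r - 1), A.submatrix f g i j =
      (shiftMat F r (j + 1) * jordanBlock F r ^ (s - (j + 1))) ⟨r - 2 - i, by omega⟩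
        ⟨r - 1, by omega⟩ * (s.choose (j + 1) : F) := by
    intro i j
    exact N_pow_entry F r s (r - 2 - i) j (by omega) (by omega) (by omega) ⟨r - 1, by omega⟩
  rw [Matrix.rank_of_det_ne_zero, Fintype.card_fin] at h1
  · exact h1
  rw [Matrix.det_of_isLowerTriangular]
  · rw [Finset.prod_ne_zero_iff]
    intro i _
    rw [hent, shiftMat_mul_apply, dif_pos (by simp only; omega),
      choose_cast_ne_zero F p hp m s h _ (by omega)]
    have e : (⟨r - 2 - i + (i + 1), by omega⟩ : Fin r) = ⟨r - 1, by omega⟩ :=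
      Fin.ext (by simp only; omega)
    simp only [e]
    rw [jordanBlock_pow_last F r _ _ (by simp only; omega), one_mul]
    exact pow_ne_zero _ (neg_ne_zero.2 one_ne_zero)
  · intro i j hij
    have hij' : i < j := by simpa using hij
    rw [Fin.lt_def] at hij'
    rw [hent, shiftMat_mul_apply, dif_neg (by simp only; omega), zero_mul]

theorem comb_one (r s : ℕ) (hr : 2 ≤ r) (hrs : r ≤ s) (lam : Fin r → ℕ) (hanti : Antitone lam)
    (h0 : ∑ i, lam i = r * s) (h1 : ∑ i, (lam i - (s - 1)) ≤ r)
    (h2 : 0 < ∑ i, (lam i - (s - 1 + (r - 1)))) :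
    (∀ i : Fin r, (i : ℕ) = 0 → lam i = s + r - 1) ∧
      (∀ i : Fin r, 0 < (i : ℕ) → lam i = s - 1) := by
  have hz : 0 < r := by omega
  let z : Fin r := ⟨0, hz⟩
  obtain ⟨i, _, hi⟩ := Finset.exists_ne_zero_of_sum_ne_zero h2.ne'
  have hiz : lam i ≤ lam z := hanti (Fin.le_def.2 (Nat.zero_le _))
  rw [← Finset.add_sum_erase _ _ (Finset.mem_univ z)] at h1
  have hle : ∀ j, j ≠ z → lam j ≤ s - 1 := by
    intro j hj
    have : lam j - (s - 1) ≤ ∑ x ∈ Finset.univ.erase z, (lam x - (s - 1)) :=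
      Finset.single_le_sum (f := fun x => lam x - (s - 1)) (fun _ _ => Nat.zero_le _)
        (Finset.mem_erase.2 ⟨hj, Finset.mem_univ _⟩)
    omega
  have hz' : lam z = s + r - 1 := by omega
  rw [← Finset.add_sum_erase _ _ (Finset.mem_univ z), hz'] at h0
  have hcard : ∑ x ∈ Finset.univ.erase z, (s - 1) = (r - 1) * (s - 1) := by
    simp [Finset.card_erase_of_mem]
  have hsum : ∑ x ∈ Finset.univ.erase z, lam x = ∑ x ∈ Finset.univ.erase z, (s - 1) := by
    rw [hcard]
    obtain ⟨r', rfl⟩ : ∃ r', r = r' + 1 := ⟨r - 1, by omega⟩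
    obtain ⟨s', rfl⟩ : ∃ s', s = s' + 1 := ⟨s - 1, by omega⟩
    simp only [Nat.add_sub_cancel] at *
    have e : (r' + 1) * (s' + 1) = r' * s' + r' + s' + 1 := by ring
    omega
  have heq := (Finset.sum_eq_sum_iff_of_le (fun x hx => hle x (Finset.mem_erase.1 hx).1)).1 hsum
  refine ⟨fun j hj => ?_, fun j hj => heq j (Finset.mem_erase.2 ⟨?_, Finset.mem_univ _⟩)⟩
  · rw [← hz']
    congr 1
    exact Fin.ext hj
  · intro e
    rw [e] at hj
    exact absurd hj (lt_irrefl _)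

theorem comb_two (r s : ℕ) (hr : 2 ≤ r) (hrs : r ≤ s) (lam : Fin r → ℕ) (hanti : Antitone lam)
    (h0 : ∑ i, lam i = r * s) (h1 : ∑ i, (lam i - (s + 1)) = 0)
    (h2 : r - 1 ≤ ∑ i, (lam i - s)) :
    (∀ i : Fin r, (i : ℕ) + 1 < r → lam i = s + 1) ∧
      (∀ i : Fin r, (i : ℕ) + 1 = r → lam i = s - (r - 1)) := by
  let z : Fin r := ⟨r - 1, by omega⟩
  have hle : ∀ j, lam j ≤ s + 1 := by
    intro j
    have := Finset.sum_eq_zero_iff.1 h1 j (Finset.mem_univ _)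
    omega
  have hcard : ∀ c, ∑ x ∈ Finset.univ.erase z, c = (r - 1) * c := by
    intro c
    simp [Finset.card_erase_of_mem]
  have hmain : ∀ i : Fin r, (i : ℕ) + 1 < r → lam i = s + 1 := by
    intro i hi
    by_contra hne
    have hi' : lam i ≤ s := by have := hle i; omega
    have hlast : lam z ≤ lam i := hanti (Fin.le_def.2 (by simp only [z]; omega))
    rw [← Finset.add_sum_erase _ _ (Finset.mem_univ z)] at h2
    have hlt : ∑ x ∈ Finset.univ.erase z, (lam x - s) < ∑ x ∈ Finset.univ.erase z, 1 := by
      apply Finset.sum_lt_sum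
      · intro x _
        have := hle x
        omega
      · refine ⟨i, Finset.mem_erase.2 ⟨?_, Finset.mem_univ _⟩, by omega⟩
        intro e
        have := congrArg Fin.val e
        simp only [z] at this
        omega
    rw [hcard] at hlt
    omega
  refine ⟨hmain, fun i hi => ?_⟩
  have hiz : i = z := Fin.ext (by simp only [z]; omega)
  rw [← Finset.add_sum_erase _ _ (Finset.mem_univ z),
    Finset.sum_congr rfl (g := fun _ => s + 1), hcard] at h0
  · rw [hiz]
    obtain ⟨r', rfl⟩ : ∃ r', r = r' + 1 := ⟨r - 1, by omega⟩
    simp only [Nat.add_sub_cancel] at *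
    have e : (r' + 1) * s = r' * s + s := by ring
    have e' : r' * (s + 1) = r' * s + r' := by ring
    omega
  · intro x hx
    apply hmain
    have : (x : ℕ) ≠ r - 1 := fun e => (Finset.mem_erase.1 hx).1 (Fin.ext e)
    omega

/-- If `p^{m-1} < r ≤ min{s, p^m}` and `s ≡ 1 (mod p^m)`, then
`ε(r,s,p) = (r-1, -1, …, -1)`, i.e. `λ_1 = s+r-1` and `λ_i = s-1` for `i ≥ 2`.
Dually, if `s ≡ -1 (mod p^m)`, then `ε(r,s,p) = (1, …, 1, -(r-1))`, i.e.
`λ_i = s+1` for `i < r` and `λ_r = s-(r-1)`. -/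
theorem stmt17 (F : Type*) [Field F] (p : ℕ) [CharP F p] (hp : p.Prime)
    (m r s : ℕ) (hm : p ^ (m - 1) < r) (hrpm : r ≤ p ^ m) (hrs : r ≤ s)
    (lam : Fin r → ℕ)
    (hlam : IsJordanSeq (jordanBlock F r ⊗ₖ jordanBlock F s) lam) :
    (s % p ^ m = 1 →
      (∀ i : Fin r, (i : ℕ) = 0 → lam i = s + r - 1) ∧
      (∀ i : Fin r, 0 < (i : ℕ) → lam i = s - 1)) ∧
    (p ^ m ∣ s + 1 →
      (∀ i : Fin r, (i : ℕ) + 1 < r → lam i = s + 1) ∧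
      (∀ i : Fin r, (i : ℕ) + 1 = r → lam i = s - (r - 1))) := by
  have hr : 2 ≤ r := by
    have := Nat.pow_pos (n := m - 1) hp.pos
    omega
  obtain ⟨hanti, _, hrank⟩ := hlam
  have h0 : ∑ i, lam i = r * s := by
    have := hrank 0
    simpa [Matrix.rank_one] using this.symm
  constructor
  · intro h
    have hsq : p ^ m * (s / p ^ m) = s - 1 := by
      have := Nat.div_add_mod s (p ^ m)
      omega
    have hN := N_pow_mul_q F p hp m r s (s / p ^ m) (by omega) (by omega) hrpm
    rw [hsq] at hN
    refine comb_one r s hr hrs lam hanti h0 ?_ ?_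
    · rw [← hrank, hN]
      exact rank_top_le F r s (by omega)
    · rw [← hrank, pow_add, hN, top_mul_pow F r s _ (by omega)]
      apply rank_pos_of_ne _ (⟨0, by omega⟩, ⟨0, by omega⟩) (⟨r - 1, by omega⟩, ⟨s - 1, by omega⟩)
      simp [Matrix.kronecker_apply, shiftMat]
  · intro h
    refine comb_two r s hr hrs lam hanti h0 ?_ ?_
    · obtain ⟨a, ha⟩ := h
      rw [← hrank, ha, N_pow_mul_q F p hp m r s a (by omega) (by omega) hrpm,
        shiftMat_eq_zero F s _ (by omega), Matrix.kronecker_zero, Matrix.rank_zero]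
    · rw [← hrank]
      exact rank_N_pow_ge F p hp m r s hr hrpm hrs h
end

section
/- For fixed r \u2265 1, as s ranges over integers with s \u2265 r and p ranges over all primes, the number of distinct deviation vectors \u03b5(r,s,p) is at most 2^{r-1}. -/
open Matrix Kronecker

/-! ### Numeric lemmas -/

theorem num1 (a : ℕ → ℕ) (h1 : ∀ i, a i ≤ a (i+1) + 1) (h2 : ∀ i, a (i+1) ≤ a i)
    (h3 : ∀ i, a i ≠ 0 → a (i+1) ≠ a i) (i : ℕ) : a i = a 0 - i := by
  induction i with
  | zero => simp
  | succ i ih =>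
    have := h1 i; have := h2 i; have := h3 i
    omega

theorem num2 (t : ℕ → ℕ) (L : ℕ) (h1 : ∀ i, t i ≤ t (i+1) + 1) (h2 : ∀ i, t (i+1) ≤ t i)
    (h3 : ∀ i, i + 1 < L → t (i+1) ≠ t i → t (i+2) ≠ t (i+1))
    (h0 : ∀ i, L ≤ i → t i = 0) (i : ℕ) : t i = min (t 0) (L - i) := by
  have hle : ∀ m i, L ≤ i + m → t i ≤ m := by
    intro m
    induction m with
    | zero => intro i hi; rw [h0 i (by omega)]
    | succ m ih => intro i hi; have := ih (i+1) (by omega); have := h1 i; omega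
  have hdrop : ∀ i, t (i+1) ≠ t i → ∀ m, i + 1 + m ≤ L →
      t (i+1) = t (i+1+m) + m ∧ t (i+m+1) ≠ t (i+m) := by
    intro i hi m
    induction m with
    | zero => intro _; exact ⟨by simp, hi⟩
    | succ m ih =>
      intro hm
      obtain ⟨e1, e2⟩ := ih (by omega)
      have e3 := h3 (i+m) (by omega) e2
      have e4 := h1 (i+m+1)
      have e5 := h2 (i+m+1)
      have q1 : i + 1 + m = i + m + 1 := by omega
      have q2 : i + 1 + (m+1) = i + m + 2 := by omega
      have q3 : i + (m+1) = i + m + 1 := by omega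
      rw [q1] at e1
      rw [q2, q3]
      refine ⟨?_, e3⟩
      have q4 : i + m + 1 + 1 = i + m + 2 := by omega
      rw [q4] at e4 e5
      omega
  have hmono : ∀ i, t i ≤ t 0 := by
    intro i
    induction i with
    | zero => exact le_rfl
    | succ i ih => exact (h2 i).trans ih
  have key : ∀ i, t i = t 0 ∨ t i = L - i := by
    intro i
    induction i with
    | zero => left; rfl
    | succ i ih =>
      have a1 := hle (L - (i+1)) (i+1) (by omega)
      have a2 := h1 i
      rcases ih with ih | ih
      · by_cases hd : t (i+1) = t i
        · left; omega
        · right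
          have hiL : i < L := by
            by_contra hcon
            exact hd (by rw [h0 i (by omega), h0 (i+1) (by omega)])
          have := (hdrop i hd (L - (i+1)) (by omega)).1
          omega
      · right; omega
  have := hle (L - i) i (by omega)
  have := hmono i
  rcases key i with h | h <;> omega

theorem num_sum1 (n m : ℕ) (h : n ≤ m) :
    2 * ∑ i ∈ Finset.range m, (n - (i+1)) = n * (n - 1) := by
  induction m, h using Nat.le_induction with
  | base =>
    have h1 : ∑ i ∈ Finset.range n, (n - (i+1)) = ∑ i ∈ Finset.range n, i := by
      rw [← Finset.sum_range_reflect (fun i => i) n]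
      exact Finset.sum_congr rfl fun i _ => by omega
    rw [h1, mul_comm, Finset.sum_range_id_mul_two]
  | succ m hm ih =>
    rw [Finset.sum_range_succ, mul_add, ih]
    have : n - (m+1) = 0 := by omega
    simp [this]

theorem num_sum2 (n L E : ℕ) (h : n ≤ L) (hLE : L ≤ E) :
    2 * ∑ i ∈ Finset.range E, min n (L - i) + n * (n - 1) = 2 * (n * L) := by
  have h1 : ∑ i ∈ Finset.range E, min n (L - i) = ∑ i ∈ Finset.range L, min n (L - i) := by
    symm
    apply Finset.sum_subset
    · intro i; simp; omega
    · intro i _ hi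
      simp at hi
      have : L - i = 0 := by omega
      simp [this]
  have h2 : ∑ i ∈ Finset.range L, min n (L - i) = ∑ i ∈ Finset.range L, min n (i+1) := by
    rw [← Finset.sum_range_reflect (fun i => min n (i+1)) L]
    refine Finset.sum_congr rfl fun i hi => ?_
    simp at hi
    congr 1; omega
  have h3 : ∑ i ∈ Finset.range L, min n (i+1) + ∑ i ∈ Finset.range L, (n - (i+1)) = n * L := by
    rw [← Finset.sum_add_distrib, Finset.sum_congr rfl (g := fun _ => n) (fun i _ => by omega)]
    simp [mul_comm]
  have h4 := num_sum1 n L h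
  rw [h1, h2]; omega

theorem num_final (R : ℕ → ℕ) (n L E : ℕ) (hLE : L ≤ E) (hn : n ≤ L)
    (hE : R E = 0) (h : ∀ i, R i + (n - (i+1)) = R (i+1) + min n (L - i)) :
    R 0 + n * (n - 1) = n * L := by
  have : ∀ m, R 0 + ∑ i ∈ Finset.range m, (n - (i+1)) =
      R m + ∑ i ∈ Finset.range m, min n (L - i) := by
    intro m
    induction m with
    | zero => simp
    | succ m ih =>
      rw [Finset.sum_range_succ, Finset.sum_range_succ]
      have := h m
      omega
  have h1 := this E
  have h2 := num_sum1 n E (hn.trans hLE)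
  have h3 := num_sum2 n L E hn hLE
  omega

/-! ### Abstract graded argument -/

theorem fr_map {F V : Type*} [Field F] [AddCommGroup V] [Module F V] [FiniteDimensional F V]
    (f : V →ₗ[F] V) (p : Submodule F V) :
    Module.finrank F (p.map f) + Module.finrank F (p ⊓ LinearMap.ker f : Submodule F V)
      = Module.finrank F p := by
  have h := LinearMap.finrank_range_add_finrank_ker (f.domRestrict p)
  rw [LinearMap.range_domRestrict] at h
  rw [← h]
  congr 1
  rw [LinearMap.ker_domRestrict]
  rw [← Submodule.map_comap_subtype, Submodule.finrank_map_subtype_eq]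

structure GrData (F V : Type*) [Field F] [AddCommGroup V] [Module F V] where
  x : V →ₗ[F] V
  z : V →ₗ[F] V
  W : ℕ → Submodule F V
  τ : ℕ → V →ₗ[F] V
  φ : ℕ → V →ₗ[F] F
  v0 : V
  E : ℕ
  comm : ∀ v, x (z v) = z (x v)
  W0 : W 0 = ⊤
  WE : W E = ⊥
  anti : Antitone W
  hx : ∀ i v, v ∈ W i → x v ∈ W (i+1)
  hz : ∀ i v, v ∈ W i → z v ∈ W (i+1)
  τmem : ∀ i v, τ i v ∈ W i
  τid : ∀ i v, v ∈ W i → τ i v = v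
  τz : ∀ i v, z (τ i v) = τ (i+1) (z v)
  gen : ∀ i, W i ≤ W (i+1) ⊔ (W (i-1)).map z ⊔ Submodule.span F {(x ^ i) v0}
  hφ : ∀ i v, v ∈ W i → z v = 0 → φ i v = 0 → v ∈ W (i+1)
  soc : ∀ i v, i + 1 < E → v ∈ W i → z v = 0 → x v ∈ W (i+2) → v ∈ W (i+1)

namespace GrData

variable {F V : Type*} [Field F] [AddCommGroup V] [Module F V] (G : GrData F V)

theorem zpow_mem (k i : ℕ) (v : V) (hv : v ∈ G.W i) : (G.z ^ k) v ∈ G.W (i + k) := by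
  induction k with
  | zero => simpa using hv
  | succ k ih => rw [pow_succ']; exact G.hz _ _ ih

theorem comm_pow (k : ℕ) (v : V) : G.x ((G.z ^ k) v) = (G.z ^ k) (G.x v) := by
  induction k generalizing v with
  | zero => simp
  | succ k ih =>
    rw [pow_succ, Module.End.mul_apply, Module.End.mul_apply, ih, G.comm]

theorem τz_pow (k i : ℕ) (v : V) : (G.z ^ k) (G.τ i v) = G.τ (i+k) ((G.z ^ k) v) := by
  induction k with
  | zero => simp
  | succ k ih =>
    rw [pow_succ', Module.End.mul_apply, Module.End.mul_apply, ih, G.τz]; rfl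

def U (k i : ℕ) : Submodule F V := (G.W i).map (G.z ^ k)

theorem mem_U {k i : ℕ} {u : V} : u ∈ G.U k i ↔ ∃ w ∈ G.W i, (G.z ^ k) w = u := Iff.rfl

theorem U_anti (k : ℕ) : Antitone (G.U k) := fun _ _ h => Submodule.map_mono (G.anti h)

theorem U_succ (k i : ℕ) : G.U (k+1) i = (G.U k i).map G.z := by
  unfold U
  rw [pow_succ', Module.End.mul_eq_comp, Submodule.map_comp]

theorem U_le_W (k i : ℕ) : G.U k i ≤ G.W (i + k) := by
  rintro _ ⟨w, hw, rfl⟩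
  exact G.zpow_mem k i w hw

theorem strict (k i j : ℕ) (u : V) (hu : u ∈ G.U k j) (hW : u ∈ G.W (i + k)) : u ∈ G.U k i := by
  obtain ⟨w, _, rfl⟩ := hu
  refine ⟨G.τ i w, G.τmem _ _, ?_⟩
  rw [G.τz_pow, G.τid _ _ hW]

theorem U'_le (k i : ℕ) : G.U (k+1) (i-1) ≤ G.U k i := by
  rintro _ ⟨w, hw, rfl⟩
  rw [pow_succ]
  exact ⟨G.z w, G.anti (by omega) (G.hz _ _ hw), rfl⟩

theorem inf_eq (k i : ℕ) : G.U k (i+1) ⊓ G.U (k+1) (i-1) = G.U (k+1) i := by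
  apply le_antisymm
  · rintro u ⟨h1, h2⟩
    refine G.strict (k+1) i _ u h2 ?_
    have := G.U_le_W _ _ h1
    rwa [show i + (k+1) = i + 1 + k by omega]
  · refine le_inf (G.U'_le k (i+1)) (G.U_anti _ (by omega))

theorem U_gen (k i : ℕ) : G.U k i ≤ G.U k (i+1) ⊔ G.U (k+1) (i-1) ⊔
    Submodule.span F {(G.z ^ k) ((G.x ^ i) G.v0)} := by
  have h := Submodule.map_mono (f := G.z ^ k) (G.gen i)
  rw [Submodule.map_sup, Submodule.map_sup, Submodule.map_span, Set.image_singleton,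
    ← Submodule.map_comp, ← Module.End.mul_eq_comp, ← pow_succ] at h
  exact h

theorem x_U (k i : ℕ) (u : V) (hu : u ∈ G.U k i) : G.x u ∈ G.U k (i+1) := by
  obtain ⟨w, hw, rfl⟩ := hu
  exact ⟨G.x w, G.hx _ _ hw, (G.comm_pow _ _).symm⟩

theorem U_zero (k i : ℕ) (h : G.E ≤ i + k) : G.U k i = ⊥ := by
  rw [eq_bot_iff, ← G.WE]
  exact (G.U_le_W k i).trans (G.anti h)

theorem step (k i : ℕ) (h : G.U k i ≤ G.U k (i+1) ⊔ G.U (k+1) (i-1)) :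
    G.U k (i+1) ≤ G.U k (i+2) ⊔ G.U (k+1) i := by
  refine (G.U_gen k (i+1)).trans (sup_le (sup_le le_sup_left le_sup_right) ?_)
  rw [Submodule.span_le, Set.singleton_subset_iff]
  have hm : (G.z ^ k) ((G.x ^ (i+1)) G.v0) = G.x ((G.z ^ k) ((G.x ^ i) G.v0)) := by
    rw [G.comm_pow, pow_succ']; rfl
  rw [hm]
  by_cases hi : (G.x ^ i) G.v0 ∈ G.W i
  · have : (G.z ^ k) ((G.x ^ i) G.v0) ∈ G.U k i := ⟨_, hi, rfl⟩
    obtain ⟨a, ha, b, hb, hab⟩ := Submodule.mem_sup.1 (h this)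
    rw [← hab, map_add]
    refine Submodule.add_mem_sup (G.x_U _ _ _ ha) ?_
    exact G.U_anti _ (by omega) (G.x_U _ _ _ hb)
  · exfalso
    apply hi
    clear hi h hm
    induction i with
    | zero => rw [G.W0]; trivial
    | succ i ih => rw [pow_succ']; exact G.hx _ _ ih

theorem le_of_step (k i : ℕ) (h : G.U k i ≤ G.U k (i+1) ⊔ G.U (k+1) (i-1)) :
    G.U k i ≤ G.U (k+1) (i-1) := by
  have : ∀ m i, G.E ≤ i + m → G.U k i ≤ G.U k (i+1) ⊔ G.U (k+1) (i-1) →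
      G.U k i ≤ G.U (k+1) (i-1) := by
    intro m
    induction m with
    | zero => intro i hi _; rw [G.U_zero k i (by omega)]; exact bot_le
    | succ m ih =>
      intro i hi h
      have h1 := ih (i+1) (by omega) (G.step k i h)
      refine h.trans (sup_le (h1.trans (G.U_anti _ (by omega))) le_rfl)
  exact this G.E i (by omega) h

variable [FiniteDimensional F V]

noncomputable def R (k i : ℕ) : ℕ := Module.finrank F (G.U k i)

theorem fact1 (k i : ℕ) : G.R k i = G.R (k+1) (i-1) + ((G.R k 0 - G.R (k+1) 0) - i) := by
  have hle : ∀ i, G.R (k+1) (i-1) ≤ G.R k i := fun i => Submodule.finrank_mono (G.U'_le k i)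
  have hsup : ∀ i, Module.finrank F (G.U k (i+1) ⊔ G.U (k+1) (i-1) : Submodule F V) + G.R (k+1) i
      = G.R k (i+1) + G.R (k+1) (i-1) := by
    intro i
    have := Submodule.finrank_sup_add_finrank_inf_eq (G.U k (i+1)) (G.U (k+1) (i-1))
    rw [G.inf_eq] at this
    exact this
  have hsle : ∀ i, G.U k (i+1) ⊔ G.U (k+1) (i-1) ≤ G.U k i := fun i =>
    sup_le (G.U_anti _ (by omega)) (G.U'_le k i)
  have := num1 (fun i => G.R k i - G.R (k+1) (i-1)) ?_ ?_ ?_ i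
  · have h2 := hle i
    simp only [Nat.zero_sub] at this
    omega
  · intro i
    have h1 := Submodule.finrank_mono (G.U_gen k i)
    have h2 := Submodule.finrank_add_le_finrank_add_finrank
      (G.U k (i+1) ⊔ G.U (k+1) (i-1)) (Submodule.span F {(G.z ^ k) ((G.x ^ i) G.v0)})
    have h3 := finrank_span_le_card (R := F) ({(G.z ^ k) ((G.x ^ i) G.v0)} : Set V)
    simp only [Set.toFinset_singleton, Finset.card_singleton] at h3
    have h4 := hsup i
    have h5 := hle i
    have h6 := hle (i+1)
    simp only [Nat.add_sub_cancel] at h6 ⊢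
    unfold R at *
    omega
  · intro i
    have h1 := Submodule.finrank_mono (hsle i)
    have h4 := hsup i
    have h5 := hle i
    have h6 := hle (i+1)
    simp only [Nat.add_sub_cancel] at h6 ⊢
    unfold R at *
    omega
  · intro i hi heq
    apply hi
    have h4 := hsup i
    have h5 := hle i
    have h6 := hle (i+1)
    simp only [Nat.add_sub_cancel] at h6 heq ⊢
    have h7 : G.U k (i+1) ⊔ G.U (k+1) (i-1) = G.U k i := by
      apply Submodule.eq_of_le_of_finrank_eq (hsle i)
      unfold R at *
      omega
    have h8 := Submodule.finrank_mono (G.le_of_step k i h7.ge)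
    unfold R at *
    omega

theorem fact2 (k i : ℕ) : G.R k i = G.R (k+1) i +
    min (G.R k 0 - G.R (k+1) 0) (G.E - k - i) := by
  set T : ℕ → Submodule F V := fun i => G.U k i ⊓ LinearMap.ker G.z with hT
  have hR : ∀ i, G.R (k+1) i + Module.finrank F (T i) = G.R k i := by
    intro i
    have := fr_map G.z (G.U k i)
    rw [← G.U_succ] at this
    exact this
  have Tanti : ∀ i, T (i+1) ≤ T i := fun i => inf_le_inf_right _ (G.U_anti _ (by omega))
  have TW : ∀ i, ∀ v ∈ T i, v ∈ G.W (i+k+1) → v ∈ T (i+1) := by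
    rintro i v ⟨h1, h2⟩ h3
    refine ⟨G.strict k (i+1) i v h1 ?_, h2⟩
    rwa [show i + 1 + k = i + k + 1 by omega]
  have := num2 (fun i => Module.finrank F (T i)) (G.E - k) ?_ ?_ ?_ ?_ i
  · have h1 := hR i
    have h2 := hR 0
    have : G.R k 0 - G.R (k+1) 0 = Module.finrank F (T 0) := by omega
    rw [this]
    omega
  · intro i
    have hsub : T i ⊓ LinearMap.ker (G.φ (i+k)) ≤ T (i+1) := by
      rintro v ⟨h1, h2⟩
      exact TW i v h1 (G.hφ _ _ (G.U_le_W _ _ h1.1) h1.2 h2)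
    have h1 := Submodule.finrank_mono hsub
    have h2 := LinearMap.finrank_range_add_finrank_ker ((G.φ (i+k)).domRestrict (T i))
    have h3 := Submodule.finrank_le (LinearMap.range ((G.φ (i+k)).domRestrict (T i)))
    rw [Module.finrank_self] at h3
    have h4 : Module.finrank F (LinearMap.ker ((G.φ (i+k)).domRestrict (T i))) =
        Module.finrank F (T i ⊓ LinearMap.ker (G.φ (i+k)) : Submodule F V) := by
      rw [LinearMap.ker_domRestrict, ← Submodule.map_comap_subtype,
        Submodule.finrank_map_subtype_eq]
    omega
  · intro i
    exact Submodule.finrank_mono (Tanti i)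
  · intro i hi hne heq
    apply hne
    have e1 : T (i+2) = T (i+1) := Submodule.eq_of_le_of_finrank_eq (Tanti (i+1)) heq
    have : T (i+1) = T i := by
      apply le_antisymm (Tanti i)
      intro v hv
      apply TW i v hv
      apply G.soc (i+k) v (by omega) (G.U_le_W _ _ hv.1) hv.2
      have hxv : G.x v ∈ T (i+1) := by
        refine ⟨G.x_U _ _ _ hv.1, ?_⟩
        have : G.z v = 0 := hv.2
        show G.z (G.x v) = 0
        rw [← G.comm, this, map_zero]
      rw [← e1] at hxv
      have := G.U_le_W _ _ hxv.1
      rwa [show i + 2 + k = i + k + 2 by omega] at this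
    rw [this]
  · intro i hi
    have : T i = ⊥ := by
      simp only [hT]
      rw [G.U_zero k i (by omega), bot_inf_eq]
    rw [this]; exact finrank_bot F V

theorem main (k : ℕ) :
    G.R k 0 + (G.R k 0 - G.R (k+1) 0) * ((G.R k 0 - G.R (k+1) 0) - 1)
      = (G.R k 0 - G.R (k+1) 0) * (G.E - k) := by
  apply num_final (fun i => G.R k i) _ (G.E - k) G.E (Nat.sub_le _ _)
  · have := G.fact2 k 0
    omega
  · show Module.finrank F (G.U k G.E) = 0
    rw [G.U_zero k G.E (by omega), finrank_bot]
  · intro i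
    have h1 := G.fact1 k (i+1)
    have h2 := G.fact2 k i
    simp only [Nat.add_sub_cancel] at h1
    omega

end GrData

/-! ### The concrete graded module -/

section Concrete

variable {F : Type*} [Field F] {r s : ℕ}

def ev (i j : ℕ) : (Fin r × Fin s → F) →ₗ[F] F where
  toFun v := if h : i < r ∧ j < s then v (⟨i, h.1⟩, ⟨j, h.2⟩) else 0
  map_add' v w := by split_ifs <;> simp
  map_smul' c v := by split_ifs <;> simp

theorem ev_fin (v : Fin r × Fin s → F) (p : Fin r × Fin s) : ev p.1 p.2 v = v p := by
  simp [ev]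

theorem ev_out (v : Fin r × Fin s → F) (i j : ℕ) (h : ¬ (i < r ∧ j < s)) : ev i j v = 0 := by
  simp [ev, h]

theorem ev_ext (v w : Fin r × Fin s → F) (h : ∀ i j, ev i j v = ev i j w) : v = w := by
  funext p
  rw [← ev_fin v, ← ev_fin w, h]

theorem ev_mk (f : ℕ → ℕ → F) (i j : ℕ) :
    ev i j (fun p : Fin r × Fin s => f p.1 p.2) = if i < r ∧ j < s then f i j else 0 := by
  simp [ev]

def xL : (Fin r × Fin s → F) →ₗ[F] (Fin r × Fin s → F) :=
  LinearMap.pi fun p => ev (p.1 + 1) p.2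

def yL : (Fin r × Fin s → F) →ₗ[F] (Fin r × Fin s → F) :=
  LinearMap.pi fun p => ev p.1 (p.2 + 1)

theorem ev_xL (v : Fin r × Fin s → F) (i j : ℕ) : ev i j (xL v) = ev (i+1) j v := by
  refine (ev_mk (fun a b => ev (a+1) b v) i j).trans ?_
  split_ifs with h
  · rfl
  · rw [ev_out]; omega

theorem ev_yL (v : Fin r × Fin s → F) (i j : ℕ) : ev i j (yL v) = ev i (j+1) v := by
  refine (ev_mk (fun a b => ev a (b+1) v) i j).trans ?_
  split_ifs with h
  · rfl
  · rw [ev_out]; omega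

theorem ev_zL (v : Fin r × Fin s → F) (i j : ℕ) :
    ev i j ((xL + yL : (Fin r × Fin s → F) →ₗ[F] (Fin r × Fin s → F)) v)
      = ev (i+1) j v + ev i (j+1) v := by
  rw [LinearMap.add_apply, map_add, ev_xL, ev_yL]

def tau (e d : ℕ) : (Fin r × Fin s → F) →ₗ[F] (Fin r × Fin s → F) :=
  LinearMap.pi fun p => if e < p.1 + p.2 + d then 0 else ev p.1 p.2

theorem ev_tau (e d : ℕ) (v : Fin r × Fin s → F) (i j : ℕ) :
    ev i j (tau e d v) = if e < i + j + d then 0 else ev i j v := by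
  have h0 : tau e d v = fun p => (fun a b => if e < a + b + d then 0 else ev a b v) p.1 p.2 := by
    funext p
    simp only [tau, LinearMap.pi_apply]
    split_ifs <;> simp
  rw [h0]
  refine (ev_mk (fun a b => if e < a + b + d then 0 else ev a b v) i j).trans ?_
  split_ifs with h1 h2 h2
  · rfl
  · rfl
  · rfl
  · rw [ev_out _ _ _ h1]

def WW (F : Type*) [Field F] (r s e d : ℕ) : Submodule F (Fin r × Fin s → F) where
  carrier := {v | ∀ i j, e < i + j + d → ev i j v = 0}
  add_mem' := by
    intro a b ha hb i j h
    rw [map_add, ha i j h, hb i j h, add_zero]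
  zero_mem' := by intro i j _; rw [map_zero]
  smul_mem' := by
    intro c a ha i j h
    rw [map_smul, ha i j h, smul_zero]

theorem mem_WW (e d : ℕ) (v : Fin r × Fin s → F) :
    v ∈ WW F r s e d ↔ ∀ i j, e < i + j + d → ev i j v = 0 := Iff.rfl

def dl (F : Type*) [Field F] (r s a b : ℕ) : Fin r × Fin s → F :=
  fun p => if (p.1 : ℕ) = a ∧ (p.2 : ℕ) = b then 1 else 0

theorem ev_dl (a b i j : ℕ) (ha : a < r) (hb : b < s) :
    ev i j (dl F r s a b) = if i = a ∧ j = b then 1 else 0 := by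
  unfold dl
  rw [ev_mk (fun x y => if x = a ∧ y = b then (1 : F) else 0)]
  split_ifs <;> first | rfl | omega

theorem sum_dl (v : Fin r × Fin s → F) : v = ∑ p, v p • dl F r s p.1 p.2 := by
  funext q
  rw [Finset.sum_apply, Finset.sum_eq_single q]
  · simp [dl]
  · intro p _ hp
    have : ¬ ((q.1 : ℕ) = p.1 ∧ (q.2 : ℕ) = p.2) := by
      rintro ⟨h1, h2⟩
      exact hp (Prod.ext (Fin.ext h1.symm) (Fin.ext h2.symm))
    simp [dl, this]
  · simp

theorem ev_xpow (k : ℕ) (v : Fin r × Fin s → F) (i j : ℕ) :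
    ev i j ((xL ^ k) v) = ev (i+k) j v := by
  induction k generalizing i with
  | zero => simp
  | succ k ih =>
    rw [pow_succ', Module.End.mul_apply, ev_xL, ih, show i + 1 + k = i + (k+1) by omega]

theorem dl_mem (hr : 1 ≤ r) (hs : 1 ≤ s) (i a b : ℕ) (ha : a < r) (hb : b < s)
    (hab : a + b + i ≤ r + s - 2) :
    dl F r s a b ∈ WW F r s (r+s-2) (i+1) ⊔ (WW F r s (r+s-2) (i-1)).map (xL + yL) ⊔
      Submodule.span F {(xL ^ i) (dl F r s (r-1) (s-1))} := by
  induction a generalizing b with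
  | zero =>
    by_cases h1 : 0 + b + i < r + s - 2
    · refine Submodule.mem_sup_left (Submodule.mem_sup_left ?_)
      intro x y hxy
      rw [ev_dl _ _ _ _ ha hb, if_neg]; omega
    by_cases h2 : b = s - 1
    · refine Submodule.mem_sup_right ?_
      have : dl F r s 0 b = (xL ^ i) (dl F r s (r-1) (s-1)) := by
        apply ev_ext
        intro x y
        rw [ev_xpow, ev_dl _ _ _ _ ha hb, ev_dl _ _ _ _ (by omega) (by omega)]
        congr 1
        apply propext
        omega
      rw [this]
      exact Submodule.mem_span_singleton_self _
    · refine Submodule.mem_sup_left (Submodule.mem_sup_right ?_)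
      refine ⟨dl F r s 0 (b+1), ?_, ?_⟩
      · intro x y hxy
        rw [ev_dl _ _ _ _ ha (by omega), if_neg]; omega
      · apply ev_ext
        intro x y
        rw [ev_zL, ev_dl _ _ _ _ ha hb, ev_dl _ _ _ _ ha (by omega),
          ev_dl _ _ _ _ ha (by omega)]
        split_ifs <;> first | omega | simp_all
  | succ a ih =>
    by_cases h1 : a + 1 + b + i < r + s - 2
    · refine Submodule.mem_sup_left (Submodule.mem_sup_left ?_)
      intro x y hxy
      rw [ev_dl _ _ _ _ ha hb, if_neg]; omega
    by_cases h2 : b = s - 1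
    · refine Submodule.mem_sup_right ?_
      have : dl F r s (a+1) b = (xL ^ i) (dl F r s (r-1) (s-1)) := by
        apply ev_ext
        intro x y
        rw [ev_xpow, ev_dl _ _ _ _ ha hb, ev_dl _ _ _ _ (by omega) (by omega)]
        congr 1
        apply propext
        omega
      rw [this]
      exact Submodule.mem_span_singleton_self _
    · have hz : dl F r s (a+1) b = (xL + yL : (Fin r × Fin s → F) →ₗ[F] (Fin r × Fin s → F))
          (dl F r s (a+1) (b+1)) - dl F r s a (b+1) := by
        apply ev_ext
        intro x y
        rw [map_sub, ev_zL, ev_dl _ _ _ _ ha hb, ev_dl _ _ _ _ ha (by omega),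
          ev_dl _ _ _ _ ha (by omega), ev_dl _ _ _ _ (by omega) (by omega)]
        split_ifs <;> first | omega | simp_all
      rw [hz]
      refine Submodule.sub_mem _ ?_ (ih (b+1) (by omega) (by omega) (by omega))
      refine Submodule.mem_sup_left (Submodule.mem_sup_right ?_)
      refine ⟨dl F r s (a+1) (b+1), ?_, rfl⟩
      intro x y hxy
      rw [ev_dl _ _ _ _ ha (by omega), if_neg]; omega

def concrete (F : Type*) [Field F] (r s : ℕ) (hr : 1 ≤ r) (hs : 1 ≤ s) :
    GrData F (Fin r × Fin s → F) where
  x := xL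
  z := xL + yL
  W := WW F r s (r+s-2)
  τ := tau (r+s-2)
  φ d := ev (min (r+s-2-d) (r-1)) (r+s-2-d - min (r+s-2-d) (r-1))
  v0 := dl F r s (r-1) (s-1)
  E := r+s-1
  comm v := by
    apply ev_ext
    intro i j
    rw [ev_xL, ev_zL, ev_zL, ev_xL, ev_xL]
  W0 := by
    rw [eq_top_iff]
    intro v _ i j h
    apply ev_out; omega
  WE := by
    rw [eq_bot_iff]
    intro v hv
    rw [Submodule.mem_bot]
    apply ev_ext
    intro i j
    rw [hv i j (by omega), map_zero]
  anti := by
    intro a b hab v hv i j h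
    exact hv i j (by omega)
  hx := by
    intro d v hv i j h
    rw [ev_xL]; exact hv _ _ (by omega)
  hz := by
    intro d v hv i j h
    rw [ev_zL, hv _ _ (by omega), hv _ _ (by omega), add_zero]
  τmem := by
    intro d v i j h
    rw [ev_tau, if_pos h]
  τid := by
    intro d v hv
    apply ev_ext
    intro i j
    rw [ev_tau]
    split_ifs with h
    · rw [hv _ _ h]
    · rfl
  τz := by
    intro d v
    apply ev_ext
    intro i j
    rw [ev_zL, ev_tau, ev_tau, ev_tau, ev_zL]
    split_ifs <;> first | omega | simp_all
  gen := by
    intro i v hv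
    rw [sum_dl v]
    refine Submodule.sum_mem _ fun p _ => ?_
    by_cases hp : r + s - 2 < p.1 + p.2 + i
    · have := hv _ _ hp
      rw [ev_fin] at this
      rw [this, zero_smul]
      exact Submodule.zero_mem _
    · exact Submodule.smul_mem _ _ (dl_mem hr hs i _ _ p.1.2 p.2.2 (by omega))
  hφ := by
    intro d v hv hz hφ i j hij
    by_cases h1 : r + s - 2 < i + j + d
    · exact hv _ _ h1
    have hm : i + j = r + s - 2 - d := by omega
    have hlink : ∀ a b, ev (a+1) b v + ev a (b+1) v = 0 := by
      intro a b
      rw [← ev_zL, hz, map_zero]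
    have key : ∀ m a, a + m = min (r+s-2-d) (r-1) → ev a (r+s-2-d-a) v = 0 := by
      intro m
      induction m with
      | zero => intro a ha; rw [show a = min (r+s-2-d) (r-1) by omega]; exact hφ
      | succ m ih =>
        intro a ha
        have h2 := ih (a+1) (by omega)
        have h3 := hlink a (r+s-2-d-(a+1))
        rw [h2, zero_add] at h3
        rwa [show r+s-2-d-(a+1)+1 = r+s-2-d-a by omega] at h3
    by_cases hi : i < r
    · have := key (min (r+s-2-d) (r-1) - i) i (by omega)
      rwa [show r+s-2-d-i = j by omega] at this
    · apply ev_out; omega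
  soc := by
    intro d v hd hv hz hx i j hij
    by_cases h1 : r + s - 2 < i + j + d
    · exact hv _ _ h1
    rcases i with _ | i
    · rcases j with _ | j
      · omega
      · have h2 : ev (0+1) j v + ev 0 (j+1) v = 0 := by
          rw [← ev_zL, hz, map_zero]
        have h3 := hx 0 j (by omega)
        rw [ev_xL] at h3
        rwa [h3, zero_add] at h2
    · have h3 := hx i j (by omega)
      rwa [ev_xL] at h3

end Concrete

/-! ### Link with matrices -/

section Link

variable {F : Type*} [Field F] {r s : ℕ}

theorem jb_sub_one (k : ℕ) (i j : Fin k) :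
    (jordanBlock F k - 1) i j = if (j : ℕ) = i + 1 then 1 else 0 := by
  rw [Matrix.sub_apply, jordanBlock, Matrix.of_apply, Matrix.one_apply]
  by_cases h : j = i
  · subst h; simp
  · have h' : ¬ i = j := fun e => h e.symm
    simp [h, h']

theorem jb_det (k : ℕ) : (jordanBlock F k).det = 1 := by
  rw [Matrix.det_of_isUpperTriangular]
  · apply Finset.prod_eq_one
    intro i _
    simp [jordanBlock]
  · intro i j hij
    simp only [id] at hij
    have h1 : ¬ j = i := by rintro rfl; exact lt_irrefl _ hij
    have h2 : ¬ (j : ℕ) = i + 1 := by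
      have : (j : ℕ) < i := hij
      omega
    simp [jordanBlock, h1, h2]

/-- The graded nilpotent matrix. -/
def Zm (F : Type*) [Field F] (r s : ℕ) : Matrix (Fin r × Fin s) (Fin r × Fin s) F :=
  (jordanBlock F r - 1) ⊗ₖ (1 : Matrix (Fin s) (Fin s) F) +
    (1 : Matrix (Fin r) (Fin r) F) ⊗ₖ (jordanBlock F s - 1)

theorem Zm_mulVec : (Zm F r s).mulVecLin = xL + yL := by
  apply LinearMap.ext
  intro v
  funext p
  obtain ⟨i, j⟩ := p
  rw [Matrix.mulVecLin_apply, Zm, Matrix.add_mulVec, Pi.add_apply, LinearMap.add_apply,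
    Pi.add_apply]
  congr 1
  · show ∑ q : Fin r × Fin s, _ * v q = _
    rw [Fintype.sum_prod_type]
    simp only [Matrix.kroneckerMap_apply, jb_sub_one, Matrix.one_apply]
    simp only [xL, LinearMap.pi_apply, ev, LinearMap.coe_mk, AddHom.coe_mk]
    split_ifs with h
    · rw [Finset.sum_eq_single ⟨i+1, h.1⟩]
      · simp
      · intro b _ hb
        have : ¬ (b : ℕ) = i + 1 := fun e => hb (Fin.ext e)
        simp [this]
      · simp
    · apply Finset.sum_eq_zero
      intro b _
      have : ¬ (b : ℕ) = i + 1 := fun e => h ⟨by have := b.2; omega, j.2⟩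
      simp [this]
  · show ∑ q : Fin r × Fin s, _ * v q = _
    rw [Fintype.sum_prod_type_right]
    simp only [Matrix.kroneckerMap_apply, jb_sub_one, Matrix.one_apply]
    simp only [yL, LinearMap.pi_apply, ev, LinearMap.coe_mk, AddHom.coe_mk]
    split_ifs with h
    · rw [Finset.sum_eq_single ⟨j+1, h.2⟩]
      · simp
      · intro b _ hb
        have : ¬ (b : ℕ) = j + 1 := fun e => hb (Fin.ext e)
        simp [this]
      · simp
    · apply Finset.sum_eq_zero
      intro b _
      have : ¬ (b : ℕ) = j + 1 := fun e => h ⟨i.2, by have := b.2; omega⟩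
      simp [this]

def Pm (F : Type*) [Field F] (r s : ℕ) : Matrix (Fin r × Fin s) (Fin r × Fin s) F :=
  Matrix.blockDiagonal fun j : Fin s => jordanBlock F r ^ (j : ℕ)

theorem Pm_det : (Pm F r s).det = 1 := by
  rw [Pm, Matrix.det_blockDiagonal]
  apply Finset.prod_eq_one
  intro j _
  rw [Matrix.det_pow, jb_det, one_pow]

theorem Pm_mul_kron (A : Matrix (Fin r) (Fin r) F) (B : Matrix (Fin s) (Fin s) F)
    (i i' : Fin r) (j j' : Fin s) :
    (Pm F r s * (A ⊗ₖ B)) (i, j) (i', j') = (jordanBlock F r ^ (j : ℕ) * A) i i' * B j j' := by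
  rw [Matrix.mul_apply, Fintype.sum_prod_type, Matrix.mul_apply, Finset.sum_mul]
  refine Finset.sum_congr rfl fun a _ => ?_
  rw [Finset.sum_eq_single j]
  · simp [Pm, Matrix.blockDiagonal_apply, mul_assoc]
  · intro b _ hb
    simp [Pm, Matrix.blockDiagonal_apply, hb.symm]
  · simp

theorem kron_mul_Pm (A : Matrix (Fin r) (Fin r) F) (B : Matrix (Fin s) (Fin s) F)
    (i i' : Fin r) (j j' : Fin s) :
    ((A ⊗ₖ B) * Pm F r s) (i, j) (i', j') = (A * jordanBlock F r ^ (j' : ℕ)) i i' * B j j' := by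
  rw [Matrix.mul_apply, Fintype.sum_prod_type, Matrix.mul_apply, Finset.sum_mul]
  refine Finset.sum_congr rfl fun a _ => ?_
  rw [Finset.sum_eq_single j']
  · simp [Pm, Matrix.blockDiagonal_apply]; ring
  · intro b _ hb
    simp [Pm, Matrix.blockDiagonal_apply, hb]
  · simp

theorem semiconj : SemiconjBy (Pm F r s) (jordanBlock F r ⊗ₖ jordanBlock F s - 1) (Zm F r s) := by
  show Pm F r s * (jordanBlock F r ⊗ₖ jordanBlock F s - 1) = Zm F r s * Pm F r s
  rw [← Matrix.one_kronecker_one, Matrix.mul_sub, Zm, Matrix.add_mul]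
  ext ⟨i, j⟩ ⟨i', j'⟩
  rw [Matrix.sub_apply, Matrix.add_apply, Pm_mul_kron, Pm_mul_kron, kron_mul_Pm, kron_mul_Pm,
    jb_sub_one, Matrix.one_apply, mul_one, one_mul, sub_mul, one_mul, ← pow_succ, ← pow_succ',
    Matrix.sub_apply, show jordanBlock F s j j' =
      if j' = j then 1 else if (j' : ℕ) = (j : ℕ) + 1 then 1 else 0 from rfl]
  by_cases h : j = j'
  · subst h; simp
  · have h' : ¬ j' = j := fun e => h e.symm
    by_cases h2 : (j' : ℕ) = j + 1
    · simp [h, h', h2]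
    · simp [h, h', h2]

theorem rank_eq (hr : 1 ≤ r) (hs : 1 ≤ s) (k : ℕ) :
    ((jordanBlock F r ⊗ₖ jordanBlock F s - 1) ^ k).rank = (concrete F r s hr hs).R k 0 := by
  have h := (semiconj (F := F) (r := r) (s := s)).pow_right k
  have hu : IsUnit (Pm F r s).det := by rw [Pm_det]; exact isUnit_one
  rw [← Matrix.rank_mul_eq_right_of_isUnit_det _ _ hu, h.eq,
    Matrix.rank_mul_eq_left_of_isUnit_det _ _ hu]
  unfold GrData.R GrData.U Matrix.rank
  rw [(concrete F r s hr hs).W0, Submodule.map_top]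
  have : (Zm F r s ^ k).mulVecLin = (xL + yL) ^ k := by
    rw [← Zm_mulVec, ← Matrix.toLin'_apply', ← Matrix.toLin'_apply', Matrix.toLin'_pow]
  rw [this]
  rfl

end Link

/-! ### Combinatorics of the break points -/

theorem break_sum (r s : ℕ) (l : ℕ → ℕ) (hl : Antitone l)
    (h : ∀ k, ∑ i ∈ Finset.range r, (l i - k) +
      (∑ i ∈ Finset.range r, (l i - k) - ∑ i ∈ Finset.range r, (l i - (k+1))) *
      ((∑ i ∈ Finset.range r, (l i - k) - ∑ i ∈ Finset.range r, (l i - (k+1))) - 1) =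
      (∑ i ∈ Finset.range r, (l i - k) - ∑ i ∈ Finset.range r, (l i - (k+1))) * (r + s - 1 - k))
    (j : ℕ) (hj : j + 1 ≤ r) (hb : l (j+1) < l j) :
    ∑ i ∈ Finset.range (j+1), ((l i : ℤ) - s) = (j+1) * (r - (j+1)) := by
  have hk := h (l (j+1))
  set k := l (j+1) with hkdef
  have hcut : ∀ m, k ≤ m → ∑ i ∈ Finset.range r, (l i - m) = ∑ i ∈ Finset.range (j+1), (l i - m) := by
    intro m hm
    symm
    apply Finset.sum_subset
    · intro i; simp; omega
    · intro i _ hi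
      simp at hi
      have := hl (show j + 1 ≤ i by omega)
      omega
  have hgt : ∀ i ∈ Finset.range (j+1), k + 1 ≤ l i := by
    intro i hi
    simp at hi
    have := hl (show i ≤ j by omega)
    omega
  have hD : ((∑ i ∈ Finset.range (j+1), (l i - k) : ℕ) : ℤ) =
      ∑ i ∈ Finset.range (j+1), (l i : ℤ) - (j+1) * k := by
    push_cast
    rw [Finset.sum_congr rfl (g := fun i => (l i : ℤ) - k)]
    · simp
    · intro i hi
      have := hgt i hi
      omega
  have hdiff : ∑ i ∈ Finset.range (j+1), (l i - k) =
      ∑ i ∈ Finset.range (j+1), (l i - (k+1)) + (j + 1) := by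
    have : ∑ i ∈ Finset.range (j+1), (l i - k) = ∑ i ∈ Finset.range (j+1), ((l i - (k+1)) + 1) := by
      apply Finset.sum_congr rfl
      intro i hi
      have := hgt i hi
      omega
    rw [this, Finset.sum_add_distrib]
    simp
  rw [hcut k le_rfl, hcut (k+1) (by omega)] at hk
  have hn : ∑ i ∈ Finset.range (j+1), (l i - k) - ∑ i ∈ Finset.range (j+1), (l i - (k+1)) = j + 1 := by
    omega
  rw [hn] at hk
  have hkle : k ≤ r + s - 1 := by
    by_contra hcon
    rw [show r + s - 1 - k = 0 by omega] at hk
    omega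
  have hk' : ((∑ i ∈ Finset.range (j+1), (l i - k) : ℕ) : ℤ) + (j+1) * j =
      (j+1) * ((r:ℤ) + s - 1 - k) := by
    have e : ((r + s - 1 - k : ℕ) : ℤ) = (r:ℤ) + s - 1 - k := by omega
    rw [← e]
    exact_mod_cast hk
  rw [hD] at hk'
  rw [Finset.sum_sub_distrib]
  simp
  linarith

theorem uniq (r : ℕ) (g : ℕ → ℤ) (B : ℕ → Prop) (hB : ∀ j, j + 1 < r → ¬ B j → g (j+1) = g j)
    (hs : ∀ j, j + 1 < r → B j → ∑ i ∈ Finset.range (j+1), g i = 0)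
    (hr : ∑ i ∈ Finset.range r, g i = 0) : ∀ i, i < r → g i = 0 := by
  intro a
  induction a using Nat.strong_induction_on with
  | _ a ih =>
    intro har
    by_contra hne
    have h0 : ∑ i ∈ Finset.range a, g i = 0 := by
      apply Finset.sum_eq_zero
      intro i hi
      simp at hi
      exact ih i hi (by omega)
    have key : ∀ m, a + m < r → g (a+m) = g a ∧
        ∑ i ∈ Finset.range (a+m+1), g i = (m+1) * g a := by
      intro m
      induction m with
      | zero => intro _; refine ⟨rfl, ?_⟩; rw [add_zero, Finset.sum_range_succ, h0]; simp
      | succ m ihm =>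
        intro hm
        obtain ⟨e1, e2⟩ := ihm (by omega)
        have hnB : ¬ B (a+m) := by
          intro hBm
          rw [hs (a+m) (by omega) hBm] at e2
          have : ((m:ℤ)+1) * g a ≠ 0 := mul_ne_zero (by positivity) hne
          exact this e2.symm
        have e3 := hB (a+m) (by omega) hnB
        have e4 : g (a + (m+1)) = g a := by
          rw [← add_assoc, e3, e1]
        refine ⟨e4, ?_⟩
        rw [Finset.sum_range_succ, e4, ← add_assoc, e2]
        push_cast; ring
    have h1 := (key (r - 1 - a) (by omega)).2
    rw [show a + (r - 1 - a) + 1 = r by omega, hr] at h1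
    have : (((r - 1 - a : ℕ) : ℤ)+1) * g a ≠ 0 := mul_ne_zero (by positivity) hne
    exact this h1.symm

/-- Extension of a vector by zero. -/
def ez {r : ℕ} (e : Fin r → ℤ) (i : ℕ) : ℤ := if h : i < r then e ⟨i, h⟩ else 0

theorem dev_breaks (r s p : ℕ) (hr : 1 ≤ r) (hs : r ≤ s) (hp : p.Prime) (lam : Fin r → ℕ)
    (hJ : IsJordanSeq (jordanBlock (ZMod p) r ⊗ₖ jordanBlock (ZMod p) s) lam)
    (e : Fin r → ℤ) (he : ∀ i : Fin r, e i = (lam i : ℤ) - (s : ℤ)) :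
    (∀ j, j + 1 < r → ez e (j+1) ≠ ez e j →
      ∑ i ∈ Finset.range (j+1), ez e i = (j+1) * (r - (j+1))) ∧
    ∑ i ∈ Finset.range r, ez e i = 0 := by
  have : Fact p.Prime := ⟨hp⟩
  obtain ⟨hanti, hpos, hrank⟩ := hJ
  set l : ℕ → ℕ := fun i => if h : i < r then lam ⟨i, h⟩ else 0 with hl
  have hlanti : Antitone l := by
    intro a b hab
    simp only [hl]
    split_ifs with h1 h2
    · exact hanti (by simpa using hab)
    · omega
    · exact Nat.zero_le _
    · exact le_rfl
  have hD : ∀ k, ∑ i ∈ Finset.range r, (l i - k) =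
      (concrete (ZMod p) r s hr (hr.trans hs)).R k 0 := by
    intro k
    rw [← rank_eq, hrank, ← Fin.sum_univ_eq_sum_range (fun i => l i - k)]
    apply Finset.sum_congr rfl
    intro i _
    simp [hl]
  have hmain : ∀ k, _ := fun k => break_sum r s l hlanti (by
    intro k
    rw [hD, hD]
    exact (concrete (ZMod p) r s hr (hr.trans hs)).main k) k
  have hez : ∀ i, i < r → ez e i = (l i : ℤ) - s := by
    intro i hi
    simp [ez, hl, hi, he]
  have hsum : ∀ j, j ≤ r → ∑ i ∈ Finset.range j, ez e i = ∑ i ∈ Finset.range j, ((l i : ℤ) - s) := by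
    intro j hj
    apply Finset.sum_congr rfl
    intro i hi
    simp at hi
    exact hez i (by omega)
  constructor
  · intro j hj hne
    rw [hsum _ (by omega)]
    apply hmain j (by omega)
    rw [hez _ hj, hez j (by omega)] at hne
    have h1 := hlanti (show j ≤ j + 1 by omega)
    have h2 : l (j+1) ≠ l j := fun e => hne (by rw [e])
    omega
  · rw [hsum r le_rfl]
    obtain ⟨q, rfl⟩ : ∃ q, r = q + 1 := ⟨r - 1, by omega⟩
    rw [hmain q le_rfl]
    · push_cast; ring
    · have h1 : l (q+1) = 0 := by simp [hl]
      have h2 : l q = lam ⟨q, by omega⟩ := by simp [hl]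
      rw [h1, h2]; exact hpos _

/-- For fixed `r ≥ 1`, as `s ≥ r` and the prime `p` vary, there are at most
`2^{r-1}` distinct deviation vectors `ε(r,s,p) = (λ_1 - s, …, λ_r - s)`.
(The Jordan partition depends on the field only through its characteristic,
so we compute it over `ZMod p`.) -/
theorem stmt19 (r : ℕ) (hr : 1 ≤ r) :
    ({e : Fin r → ℤ | ∃ s p : ℕ, r ≤ s ∧ p.Prime ∧
      ∃ lam : Fin r → ℕ,
        IsJordanSeq (jordanBlock (ZMod p) r ⊗ₖ jordanBlock (ZMod p) s) lam ∧
        ∀ i : Fin r, e i = (lam i : ℤ) - (s : ℤ)} : Set (Fin r → ℤ)).Finite ∧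
    Nat.card {e : Fin r → ℤ | ∃ s p : ℕ, r ≤ s ∧ p.Prime ∧
      ∃ lam : Fin r → ℕ,
        IsJordanSeq (jordanBlock (ZMod p) r ⊗ₖ jordanBlock (ZMod p) s) lam ∧
        ∀ i : Fin r, e i = (lam i : ℤ) - (s : ℤ)} ≤ 2 ^ (r - 1) := by
  set S : Set (Fin r → ℤ) := {e : Fin r → ℤ | ∃ s p : ℕ, r ≤ s ∧ p.Prime ∧
      ∃ lam : Fin r → ℕ,
        IsJordanSeq (jordanBlock (ZMod p) r ⊗ₖ jordanBlock (ZMod p) s) lam ∧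
        ∀ i : Fin r, e i = (lam i : ℤ) - (s : ℤ)} with hS
  let f : S → Set (Fin (r-1)) := fun e => {j | ez e.1 (j+1) ≠ ez e.1 j}
  have hf : Function.Injective f := by
    rintro ⟨e, s, p, hs, hp, lam, hJ, he⟩ ⟨e', s', p', hs', hp', lam', hJ', he'⟩ hff
    obtain ⟨a1, a2⟩ := dev_breaks r s p hr hs hp lam hJ e he
    obtain ⟨b1, b2⟩ := dev_breaks r s' p' hr hs' hp' lam' hJ' e' he'
    have hiff : ∀ j, j + 1 < r → (ez e (j+1) ≠ ez e j ↔ ez e' (j+1) ≠ ez e' j) := by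
      intro j hj
      exact Set.ext_iff.1 hff ⟨j, by omega⟩
    have hu := uniq r (fun i => ez e i - ez e' i) (fun j => ez e (j+1) ≠ ez e j) ?_ ?_ ?_
    · apply Subtype.ext
      funext i
      have := hu i i.2
      simp only [ez, i.2, dif_pos, Fin.eta] at this
      exact sub_eq_zero.1 this
    · intro j hj hB
      have hB' := (not_congr (hiff j hj)).1 hB
      rw [not_not] at hB hB'
      simp only [hB, hB']
    · intro j hj hB
      simp only [Finset.sum_sub_distrib]
      rw [a1 j hj hB, b1 j hj ((hiff j hj).1 hB), sub_self]
    · simp only [Finset.sum_sub_distrib]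
      rw [a2, b2, sub_self]
  refine ⟨Set.finite_coe_iff.1 (Finite.of_injective f hf), ?_⟩
  have h := Nat.card_le_card_of_injective f hf
  simpa [Nat.card_eq_fintype_card, Fintype.card_set] using h
end
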